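/- arXiv:2504.14455 — 8 statements merged into one kernel-verified Lean document; each statement's English description precedes it below -/
import Mathlib

section
/- Let X be a GNPC space. Then the set of manifold points of X, namely {x : X | ∃ n, ∃ U, IsOpen U ∧ x ∈ U ∧ U is homeomorphic to EuclideanSpace ℝ (Fin n)}, is open and dense in X. -/
open Set Metric

/-- A constant-speed geodesic from `x` to `y`, parametrized on `[0,1]`. -/
def IsGeodesic {X : Type*} [MetricSpace X] (γ : ℝ → X) (x y : X) : Prop :=
  γ 0 = x ∧ γ 1 = y ∧
    ∀ s ∈ Set.Icc (0:ℝ) 1, ∀ t ∈ Set.Icc (0:ℝ) 1,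
      dist (γ s) (γ t) = |s - t| * dist x y

/-- A metric space is geodesic if any two points are joined by a
constant-speed geodesic. -/
def IsGeodesicSpace (X : Type*) [MetricSpace X] : Prop :=
  ∀ x y : X, ∃ γ : ℝ → X, IsGeodesic γ x y

/-- A BNPC (Busemann nonpositively curved) space: a complete geodesic space in
which the distance between any two constant-speed geodesics is convex. -/
def IsBNPC (X : Type*) [MetricSpace X] : Prop :=
  CompleteSpace X ∧ IsGeodesicSpace X ∧
    ∀ (γ η : ℝ → X) (x y x' y' : X), IsGeodesic γ x y → IsGeodesic η x' y' →
      ConvexOn ℝ (Set.Icc (0:ℝ) 1) (fun t => dist (γ t) (η t))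

/-- A metric space is locally BNPC if every point has a closed ball of positive
radius around it which, with the induced metric, is a BNPC space. -/
def LocallyBNPC (X : Type*) [MetricSpace X] : Prop :=
  ∀ p : X, ∃ r : ℝ, 0 < r ∧ IsBNPC (Metric.closedBall p r)

/-- A topological `n`-manifold: every point has an open neighborhood
homeomorphic to `EuclideanSpace ℝ (Fin n)`. -/
def IsTopManifold (n : ℕ) (X : Type*) [TopologicalSpace X] : Prop :=
  ∀ x : X, ∃ U : Set X, IsOpen U ∧ x ∈ U ∧
    Nonempty (U ≃ₜ EuclideanSpace ℝ (Fin n))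

/-- A shortest path: an isometric map of the interval `[a,b]` into `X`. -/
def IsShortestPathOn {X : Type*} [MetricSpace X] (γ : ℝ → X) (a b : ℝ) : Prop :=
  ∀ s ∈ Set.Icc a b, ∀ t ∈ Set.Icc a b, dist (γ s) (γ t) = |s - t|

/-- Local geodesic completeness: every shortest path extends to a slightly
larger interval on which it is a local isometry (a geodesic). -/
def LocallyGeodesicallyComplete (X : Type*) [MetricSpace X] : Prop :=
  ∀ (γ : ℝ → X) (a b : ℝ), a ≤ b → IsShortestPathOn γ a b →
    ∃ ε : ℝ, 0 < ε ∧ ∃ γ' : ℝ → X,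
      (∀ t ∈ Set.Icc a b, γ' t = γ t) ∧
      ∀ t ∈ Set.Icc (a - ε) (b + ε), ∃ δ : ℝ, 0 < δ ∧
        ∀ s ∈ Set.Icc (a - ε) (b + ε) ∩ Set.Icc (t - δ) (t + δ),
          ∀ u ∈ Set.Icc (a - ε) (b + ε) ∩ Set.Icc (t - δ) (t + δ),
            dist (γ' s) (γ' u) = |s - u|

/-- A GNPC space: separable, locally compact, locally geodesically complete,
locally BNPC. -/
def IsGNPC (X : Type*) [MetricSpace X] : Prop :=
  TopologicalSpace.SeparableSpace X ∧ LocallyCompactSpace X ∧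
    LocallyGeodesicallyComplete X ∧ LocallyBNPC X

/-- A G-space: a complete, locally compact geodesic space in which shortest
paths extend locally and uniquely. -/
def IsGSpace (X : Type*) [MetricSpace X] : Prop :=
  CompleteSpace X ∧ LocallyCompactSpace X ∧ IsGeodesicSpace X ∧
    ∀ p : X, ∃ r : ℝ, 0 < r ∧
      ∀ (γ : ℝ → X) (a b : ℝ), a ≤ b → IsShortestPathOn γ a b →
        (∀ t ∈ Set.Icc a b, γ t ∈ Metric.ball p r) →
        (∃ γ' : ℝ → X, IsShortestPathOn γ' (a - r) (b + r) ∧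
          ∀ t ∈ Set.Icc a b, γ' t = γ t) ∧
        ∀ γ₁ γ₂ : ℝ → X,
          IsShortestPathOn γ₁ (a - r) (b + r) → (∀ t ∈ Set.Icc a b, γ₁ t = γ t) →
          IsShortestPathOn γ₂ (a - r) (b + r) → (∀ t ∈ Set.Icc a b, γ₂ t = γ t) →
          ∀ t ∈ Set.Icc (a - r) (b + r), γ₁ t = γ₂ t

/-- A G-space has injectivity radius `≥ r` if every shortest path of length
`< r` extends uniquely to a shortest path of length `r`. -/
def InjRadiusGE (X : Type*) [MetricSpace X] (r : ℝ) : Prop :=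
  ∀ (γ : ℝ → X) (L : ℝ), 0 < L → L < r → IsShortestPathOn γ 0 L →
    (∃ γ' : ℝ → X, IsShortestPathOn γ' 0 r ∧ ∀ t ∈ Set.Icc 0 L, γ' t = γ t) ∧
    ∀ γ₁ γ₂ : ℝ → X,
      IsShortestPathOn γ₁ 0 r → (∀ t ∈ Set.Icc 0 L, γ₁ t = γ t) →
      IsShortestPathOn γ₂ 0 r → (∀ t ∈ Set.Icc 0 L, γ₂ t = γ t) →
      ∀ t ∈ Set.Icc 0 r, γ₁ t = γ₂ t

namespace GNPCProof

theorem concat_geod {Y : Type*} [MetricSpace Y] (hG : IsGeodesicSpace Y) (x m z : Y) (t : ℝ)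
    (ht0 : 0 ≤ t) (ht1 : t ≤ 1) (h1 : dist x m = t * dist x z)
    (h2 : dist m z = (1 - t) * dist x z) : ∃ γ : ℝ → Y, IsGeodesic γ x z ∧ γ t = m := by
  rcases ht0.eq_or_lt with h | ht0
  · obtain ⟨γ, hγ⟩ := hG x z
    refine ⟨γ, hγ, ?_⟩
    rw [← h, zero_mul] at h1
    rw [← h, hγ.1]; exact dist_eq_zero.1 h1
  rcases ht1.eq_or_lt with h | ht1
  · obtain ⟨γ, hγ⟩ := hG x z
    refine ⟨γ, hγ, ?_⟩
    rw [h, sub_self, zero_mul] at h2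
    rw [h, hγ.2.1]; exact (dist_eq_zero.1 h2).symm
  obtain ⟨γ₁, a0, a1, ha⟩ := hG x m
  obtain ⟨γ₂, b0, b1, hb⟩ := hG m z
  have ht' : 0 < 1 - t := by linarith
  have fa : ∀ s, 0 ≤ s → s ≤ t → s / t ∈ Set.Icc (0:ℝ) 1 := fun s hs hst =>
    ⟨by positivity, by rw [div_le_one ht0]; exact hst⟩
  have fb : ∀ s, t ≤ s → s ≤ 1 → (s - t) / (1 - t) ∈ Set.Icc (0:ℝ) 1 := fun s hs hst =>
    ⟨div_nonneg (by linarith) ht'.le, by rw [div_le_one ht']; linarith⟩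
  have key : ∀ s u : ℝ, 0 ≤ s → s ≤ u → u ≤ 1 →
      dist ((fun s => if s ≤ t then γ₁ (s / t) else γ₂ ((s - t) / (1 - t))) s)
        ((fun s => if s ≤ t then γ₁ (s / t) else γ₂ ((s - t) / (1 - t))) u) =
        (u - s) * dist x z := by
    intro s u hs hsu hu
    by_cases hut : u ≤ t
    · have hst : s ≤ t := hsu.trans hut
      simp only [hut, hst, if_true]
      rw [ha _ (fa s hs hst) _ (fa u (hs.trans hsu) hut), h1, ← sub_div, abs_div, abs_of_pos ht0,
        abs_sub_comm, abs_of_nonneg (by linarith : 0 ≤ u - s)]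
      field_simp
    · by_cases hst : s ≤ t
      · simp only [hut, hst, if_true, if_false]
        push Not at hut
        have e1 := ha _ (fa s hs hst) 1 (by simp)
        have e2 := hb 0 (by simp) _ (fb u hut.le hu)
        have e3 := ha 0 (by simp) _ (fa s hs hst)
        have e4 := hb _ (fb u hut.le hu) 1 (by simp)
        have k1 : |s / t - 1| * dist x m = (t - s) * dist x z := by
          rw [h1, abs_sub_comm, abs_of_nonneg (by linarith [(fa s hs hst).2])]; field_simp
        have k2 : |0 - (u - t) / (1 - t)| * dist m z = (u - t) * dist x z := by
          rw [h2, zero_sub, abs_neg, abs_of_nonneg (fb u hut.le hu).1]; field_simp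
        have k3 : |0 - s / t| * dist x m = s * dist x z := by
          rw [h1, zero_sub, abs_neg, abs_of_nonneg (fa s hs hst).1]; field_simp
        have k4 : |(u - t) / (1 - t) - 1| * dist m z = (1 - u) * dist x z := by
          rw [h2, abs_sub_comm, abs_of_nonneg (by linarith [(fb u hut.le hu).2])]; field_simp
          ring
        rw [k1, a1] at e1
        rw [k2, b0] at e2
        rw [k3, a0] at e3
        rw [k4, b1] at e4
        apply le_antisymm
        · have := dist_triangle (γ₁ (s / t)) m (γ₂ ((u - t) / (1 - t)))
          linarith
        · have := dist_triangle4 x (γ₁ (s / t)) (γ₂ ((u - t) / (1 - t))) z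
          linarith
      · simp only [hut, hst, if_false]
        push Not at hut hst
        rw [hb _ (fb s hst.le (hsu.trans hu)) _ (fb u hut.le hu), h2, ← sub_div, abs_div,
          abs_of_pos ht', abs_sub_comm, abs_of_nonneg (by linarith : 0 ≤ u - t - (s - t))]
        field_simp
        ring
  refine ⟨fun s => if s ≤ t then γ₁ (s / t) else γ₂ ((s - t) / (1 - t)), ⟨?_, ?_, ?_⟩, ?_⟩
  · simp [ht0.le, a0]
  · simp only [not_le.2 ht1, if_false]; rw [div_self ht'.ne', b1]
  · intro s hs u hu
    rcases le_total s u with h | h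
    · rw [key s u hs.1 h hu.2, abs_sub_comm, abs_of_nonneg (by linarith)]
    · rw [dist_comm, key u s hu.1 h hs.2, abs_of_nonneg (by linarith)]
  · simp [div_self ht0.ne', a1]

/-- the working ball -/
structure Good {X : Type*} [MetricSpace X] (p : X) (r : ℝ) : Prop where
  pos : 0 < r
  cpt : IsCompact (closedBall p r)
  cvx : ∀ x ∈ closedBall p r, ∀ m ∈ closedBall p r, ∀ z ∈ closedBall p r,
    ∀ x' ∈ closedBall p r, ∀ m' ∈ closedBall p r, ∀ z' ∈ closedBall p r, ∀ t : ℝ, 0 ≤ t → t ≤ 1 →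
    dist x m = t * dist x z → dist m z = (1 - t) * dist x z →
    dist x' m' = t * dist x' z' → dist m' z' = (1 - t) * dist x' z' →
    dist m m' ≤ (1 - t) * dist x x' + t * dist z z'
  geo : ∀ x ∈ closedBall p r, ∀ z ∈ closedBall p r, ∀ t : ℝ, 0 ≤ t → t ≤ 1 →
    ∃ m ∈ closedBall p r, dist x m = t * dist x z ∧ dist m z = (1 - t) * dist x z
  ext : ∀ x ∈ closedBall p r, ∀ y ∈ closedBall p r, x ≠ y → dist p y < r →
    ∃ z ∈ closedBall p r, z ≠ y ∧ dist x z = dist x y + dist y z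

theorem cvx_of_BNPC {X : Type*} [MetricSpace X] {p : X} {r : ℝ}
    (h : IsBNPC (closedBall p r)) :
    ∀ x ∈ closedBall p r, ∀ m ∈ closedBall p r, ∀ z ∈ closedBall p r,
    ∀ x' ∈ closedBall p r, ∀ m' ∈ closedBall p r, ∀ z' ∈ closedBall p r, ∀ t : ℝ, 0 ≤ t → t ≤ 1 →
    dist x m = t * dist x z → dist m z = (1 - t) * dist x z →
    dist x' m' = t * dist x' z' → dist m' z' = (1 - t) * dist x' z' →
    dist m m' ≤ (1 - t) * dist x x' + t * dist z z' := by
  intro x hx m hm z hz x' hx' m' hm' z' hz' t ht0 ht1 e1 e2 e3 e4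
  obtain ⟨-, hG, hC⟩ := h
  obtain ⟨γ, hγ, hγt⟩ := concat_geod hG ⟨x, hx⟩ ⟨m, hm⟩ ⟨z, hz⟩ t ht0 ht1 e1 e2
  obtain ⟨η, hη, hηt⟩ := concat_geod hG ⟨x', hx'⟩ ⟨m', hm'⟩ ⟨z', hz'⟩ t ht0 ht1 e3 e4
  have hc := (hC γ η _ _ _ _ hγ hη).2
  have h01 : (0:ℝ) ∈ Set.Icc (0:ℝ) 1 := by simp
  have h11 : (1:ℝ) ∈ Set.Icc (0:ℝ) 1 := by simp
  have := hc h01 h11 (show 0 ≤ 1 - t by linarith) ht0 (by ring)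
  simp only [smul_eq_mul, mul_zero, mul_one, zero_add] at this
  rw [hγt, hηt, hγ.1, hγ.2.1, hη.1, hη.2.1] at this
  exact this

theorem exists_good {X : Type*} [MetricSpace X] (hX : IsGNPC X) (p : X) :
    ∃ r : ℝ, Good p r := by
  obtain ⟨-, hlc, hE, hB⟩ := hX
  obtain ⟨r₀, hr₀, hB⟩ := hB p
  obtain ⟨K, hK, hKp⟩ := exists_compact_mem_nhds p
  obtain ⟨r₁, hr₁, hr₁K⟩ := Metric.nhds_basis_closedBall.mem_iff.1 hKp
  have hsub : closedBall p (min r₀ r₁) ⊆ closedBall p r₀ := closedBall_subset_closedBall (min_le_left _ _)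
  have hpos : 0 < min r₀ r₁ := lt_min hr₀ hr₁
  have hp : p ∈ closedBall p r₀ := mem_closedBall_self hr₀.le
  have hC := cvx_of_BNPC hB
  -- convexity towards a point
  refine ⟨min r₀ r₁, hpos, ?_, ?_, ?_, ?_⟩
  · exact hK.of_isClosed_subset isClosed_closedBall
      ((closedBall_subset_closedBall (min_le_right _ _)).trans hr₁K)
  · intro x hx m hm z hz x' hx' m' hm' z' hz'
    exact hC x (hsub hx) m (hsub hm) z (hsub hz) x' (hsub hx') m' (hsub hm') z' (hsub hz')
  · intro x hx z hz t ht0 ht1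
    obtain ⟨γ, g0, g1, hγ⟩ := hB.2.1 ⟨x, hsub hx⟩ ⟨z, hsub hz⟩
    have e1 := hγ 0 (by simp) t ⟨ht0, ht1⟩
    have e2 := hγ t ⟨ht0, ht1⟩ 1 (by simp)
    rw [g0, zero_sub, abs_neg, abs_of_nonneg ht0] at e1
    rw [g1, abs_sub_comm, abs_of_nonneg (by linarith)] at e2
    refine ⟨(γ t : X), ?_, e1, e2⟩
    have := hC x (hsub hx) (γ t) (γ t).2 z (hsub hz) p hp p hp p hp t ht0 ht1 e1 e2 (by simp) (by simp)
    rw [mem_closedBall] at hx hz ⊢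
    nlinarith
  · intro x hx y hy hxy hyr
    obtain ⟨γ, g0, g1, hγ⟩ := hB.2.1 ⟨x, hsub hx⟩ ⟨y, hsub hy⟩
    have hL : 0 < dist x y := dist_pos.2 hxy
    set L := dist x y with hLdef
    have hsh : IsShortestPathOn (fun t => (γ (t / L) : X)) 0 L := by
      intro s hs t ht
      have := hγ (s / L) ⟨div_nonneg hs.1 hL.le, (div_le_one hL).2 hs.2⟩ (t / L)
        ⟨div_nonneg ht.1 hL.le, (div_le_one hL).2 ht.2⟩
      change dist (γ (s / L)) (γ (t / L)) = _
      rw [this]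
      change _ * L = _
      rw [← sub_div, abs_div, abs_of_pos hL]
      field_simp
    obtain ⟨ε, hε, γ', hγ', hloc⟩ := hE _ 0 L hL.le hsh
    obtain ⟨δ, hδ, hδ'⟩ := hloc L ⟨by linarith, by linarith⟩
    have hroom : 0 < min r₀ r₁ - dist p y := by linarith
    obtain ⟨s, hs, hs'⟩ : ∃ s > 0, s ≤ δ ∧ s ≤ ε ∧ s ≤ L ∧ s ≤ min r₀ r₁ - dist p y :=
      ⟨min (min δ ε) (min L (min r₀ r₁ - dist p y)), by positivity, by simp, by simp, by simp, by simp⟩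
    obtain ⟨h1, h2, h3, h4⟩ := hs'
    have hyL : γ' L = y := by
      rw [hγ' L ⟨hL.le, le_rfl⟩, div_self hL.ne', g1]
    have hm : γ' (L - s) = γ ((L - s) / L) := hγ' _ ⟨by linarith, by linarith⟩
    have hx0 : γ' 0 = x := by
      rw [hγ' 0 ⟨le_rfl, hL.le⟩, zero_div, g0]
    have d1 : dist (γ' (L - s)) y = s := by
      rw [← hyL, hδ' _ ⟨⟨by linarith, by linarith⟩, ⟨by linarith, by linarith⟩⟩ _ 
        ⟨⟨by linarith, by linarith⟩, ⟨by linarith, by linarith⟩⟩, abs_sub_comm, abs_of_nonneg] <;> linarith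
    have d2 : dist y (γ' (L + s)) = s := by
      rw [← hyL, hδ' _ ⟨⟨by linarith, by linarith⟩, ⟨by linarith, by linarith⟩⟩ _ 
        ⟨⟨by linarith, by linarith⟩, ⟨by linarith, by linarith⟩⟩, abs_sub_comm, abs_of_nonneg] <;> linarith
    have d3 : dist (γ' (L - s)) (γ' (L + s)) = 2 * s := by
      rw [hδ' _ ⟨⟨by linarith, by linarith⟩, ⟨by linarith, by linarith⟩⟩ _ 
        ⟨⟨by linarith, by linarith⟩, ⟨by linarith, by linarith⟩⟩, abs_sub_comm, abs_of_nonneg] <;> linarith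
    have d4 : dist x (γ' (L - s)) = L - s := by
      have := hsh 0 ⟨le_rfl, hL.le⟩ (L - s) ⟨by linarith, by linarith⟩
      rw [← hx0, hγ' 0 ⟨le_rfl, hL.le⟩, hm]
      rw [this, zero_sub, abs_neg, abs_of_nonneg (by linarith)]
    have hzB : γ' (L + s) ∈ closedBall p (min r₀ r₁) := by
      rw [mem_closedBall, dist_comm]
      linarith [dist_triangle p y (γ' (L + s))]
    refine ⟨γ' (L + s), hzB, ?_, ?_⟩
    · intro h
      rw [h, dist_self] at d2; linarith
    · have hmB : γ' (L - s) ∈ closedBall p r₀ := by rw [hm]; exact (γ ((L - s) / L)).2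
      have := hC _ hmB y (hsub hy) _ (hsub hzB) x (hsub hx) x (hsub hx) x (hsub hx) (1/2) (by norm_num)
        (by norm_num) (by rw [d1, d3]; ring) (by rw [d2, d3]; ring) (by simp) (by simp)
      rw [dist_comm y x, dist_comm _ x, dist_comm _ x, d4] at this
      have h5 := dist_triangle x y (γ' (L + s))
      rw [d2] at h5 ⊢
      apply le_antisymm h5
      change L ≤ _ at this
      change L + s ≤ _
      linarith

section main
variable {X : Type*} [MetricSpace X] {p : X} {r : ℝ}

theorem Good.cvx1 (h : Good p r) {a x m z : X} (ha : a ∈ closedBall p r) (hx : x ∈ closedBall p r)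
    (hm : m ∈ closedBall p r) (hz : z ∈ closedBall p r) (hb : dist x z = dist x m + dist m z) :
    dist a m * dist x z ≤ dist a x * dist m z + dist a z * dist x m := by
  rcases (dist_nonneg (x := x) (y := z)).eq_or_lt with h0 | h0
  · have h1 : dist x m = 0 := by linarith [dist_nonneg (x := x) (y := m), dist_nonneg (x := m) (y := z)]
    have h2 : dist m z = 0 := by linarith [dist_nonneg (x := x) (y := m), dist_nonneg (x := m) (y := z)]
    rw [← h0, h1, h2]; simp
  · have ht : dist x m / dist x z ≤ 1 := by
      rw [div_le_one h0]; linarith [dist_nonneg (x := m) (y := z)]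
    have e1 : dist x m = dist x m / dist x z * dist x z := by field_simp
    have e2 : dist m z = (1 - dist x m / dist x z) * dist x z := by
      rw [sub_mul, ← e1]; linarith
    have := h.cvx x hx m hm z hz a ha a ha a ha (dist x m / dist x z) (by positivity) ht e1 e2
      (by simp) (by simp)
    rw [dist_comm m a, dist_comm x a, dist_comm z a] at this
    calc dist a m * dist x z ≤ _ := mul_le_mul_of_nonneg_right this h0.le
      _ = dist a x * ((1 - dist x m / dist x z) * dist x z) +
          dist a z * (dist x m / dist x z * dist x z) := by ring
      _ = _ := by rw [← e1, ← e2]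

theorem Good.geoL (h : Good p r) {x z : X} (hx : x ∈ closedBall p r)
    (hz : z ∈ closedBall p r) {L : ℝ} (hL : 0 ≤ L) (hL' : L ≤ dist x z) :
    ∃ m ∈ closedBall p r, dist x m = L ∧ dist m z = dist x z - L := by
  rcases (dist_nonneg (x := x) (y := z)).eq_or_lt with h0 | h0
  · refine ⟨x, hx, ?_, ?_⟩
    · rw [dist_self]; linarith
    · linarith
  · obtain ⟨m, hm, h1, h2⟩ := h.geo x hx z hz (L / dist x z) (by positivity) ((div_le_one h0).2 hL')
    refine ⟨m, hm, ?_, ?_⟩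
    · rw [h1]; field_simp
    · rw [h2]; field_simp

theorem Good.extL (h : Good p r) {x y : X} (hx : x ∈ closedBall p (r/2))
    (hy : y ∈ closedBall p (r/2)) (hxy : x ≠ y) {L : ℝ} (hL : dist x y ≤ L) (hL' : L ≤ r / 2) :
    ∃ z ∈ closedBall p r, dist x z = L ∧ dist x z = dist x y + dist y z := by
  have hr := h.pos
  have hsub : closedBall p (r/2) ⊆ closedBall p r := closedBall_subset_closedBall (by linarith)
  have hcl : IsClosed {z : X | dist x z = dist x y + dist y z} :=
    isClosed_eq (by fun_prop) (by fun_prop)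
  obtain ⟨z₀, ⟨hz₀B, hz₀⟩, hmax⟩ := (h.cpt.inter_right hcl).exists_isMaxOn ⟨y, hsub hy, by simp⟩
    (f := fun z => dist x z) (by fun_prop)
  simp only [Set.mem_ofPred_eq] at hz₀
  have hxz : x ≠ z₀ := by
    intro e
    rw [← e, dist_self] at hz₀
    have := dist_pos.2 hxy
    linarith [dist_nonneg (x := y) (y := x)]
  have hfar : r ≤ dist p z₀ := by
    by_contra hlt
    push Not at hlt
    obtain ⟨z₁, hz₁B, hne, hz₁⟩ := h.ext x (hsub hx) z₀ hz₀B hxz hlt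
    have h1 : dist x z₁ = dist x y + dist y z₁ := by
      linarith [dist_triangle x y z₁, dist_triangle y z₀ z₁]
    have h2 : dist x z₁ ≤ dist x z₀ := hmax ⟨hz₁B, h1⟩
    have := dist_pos.2 hne
    rw [dist_comm] at this
    linarith
  have hxp : dist p x ≤ r / 2 := by rw [dist_comm]; exact hx
  have h3 := dist_triangle p x z₀
  obtain ⟨m, hm, h1, h2⟩ := h.geoL (hsub hy) hz₀B (L := L - dist x y) (by linarith) (by linarith)
  have h4 := dist_triangle x y m
  have h5 := dist_triangle x m z₀
  exact ⟨m, hm, by linarith, by linarith⟩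

/-- the distance to `a` is almost affine on `W` -/
def Aff (a : X) (ε : ℝ) (W : Set X) : Prop :=
  ∀ x ∈ W, ∀ y ∈ W, ∀ z ∈ W, dist x z = dist x y + dist y z →
    (dist a z - dist a y) * dist x y ≤ (dist a y - dist a x) * dist y z + ε * dist x y * dist y z

theorem Aff.mono {a : X} {ε : ℝ} {W W' : Set X} (h : Aff a ε W) (hW : W' ⊆ W) : Aff a ε W' :=
  fun x hx y hy z hz => h x (hW hx) y (hW hy) z (hW hz)

theorem Good.exists_aff (h : Good p r) {a : X} (ha : a ∈ closedBall p r) {ε : ℝ} (hε : 0 < ε)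
    {W : Set X} (hWo : IsOpen W) (hWn : W.Nonempty) (hWs : W ⊆ ball p (r/8)) :
    ∃ W' ⊆ W, IsOpen W' ∧ W'.Nonempty ∧ Aff a ε W' := by
  have hr := h.pos
  have : Nonempty X := ⟨p⟩
  have hg := h.geo
  choose! g hgB hg1 hg2 using hg
  have hWB : ∀ {V : Set X}, V ⊆ W → V ⊆ closedBall p r := fun hV =>
    (hV.trans hWs).trans (ball_subset_closedBall.trans (closedBall_subset_closedBall (by linarith)))
  -- Q x q t
  have step2 : ∀ q ∈ closedBall p r, ∀ κ > 0, ∀ V ⊆ W, IsOpen V → V.Nonempty →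
      ∃ V' ⊆ V, IsOpen V' ∧ V'.Nonempty ∧ ∃ e t₀ : ℝ, 0 < t₀ ∧ t₀ ≤ 1 ∧
        (∀ x ∈ V', ∀ t, 0 < t → t ≤ 1 → e ≤ (dist a (g x q t) - dist a x) / t) ∧
        ∀ x ∈ V', (dist a (g x q t₀) - dist a x) / t₀ ≤ e + κ := by
    intro q hq κ hκ V hVW hVo hVn
    set S : Set ℝ := {v | ∃ x ∈ V, ∃ t, 0 < t ∧ t ≤ 1 ∧ v = (dist a (g x q t) - dist a x) / t} with hS
    have hbdd : BddBelow S := by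
      refine ⟨-(2 * r), ?_⟩
      rintro v ⟨x, hx, t, ht0, ht1, rfl⟩
      have hxB := hWB hVW hx
      rw [le_div_iff₀ ht0]
      have h1 := hg1 x hxB q hq t ht0.le ht1
      have h2 : dist a x ≤ dist a (g x q t) + dist x (g x q t) := dist_triangle_right a x (g x q t)
      have h3 : dist x q ≤ 2 * r := by
        have := dist_triangle x p q
        rw [mem_closedBall] at hxB hq
        rw [dist_comm p q] at this; linarith
      nlinarith
    obtain ⟨x₁, hx₁⟩ := hVn
    have hSn : S.Nonempty := ⟨_, x₁, hx₁, 1, one_pos, le_rfl, rfl⟩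
    obtain ⟨v, ⟨x₀, hx₀, t₀, ht0, ht1, rfl⟩, hv⟩ := Real.lt_sInf_add_pos hSn hκ
    set v := (dist a (g x₀ q t₀) - dist a x₀) / t₀ with hvdef
    have hρ : 0 < (sInf S + κ - v) * t₀ / 2 := by
      have : 0 < sInf S + κ - v := by linarith
      positivity
    refine ⟨V ∩ ball x₀ ((sInf S + κ - v) * t₀ / 2), inter_subset_left, hVo.inter isOpen_ball,
      ⟨x₀, hx₀, mem_ball_self hρ⟩, sInf S, t₀, ht0, ht1, ?_, ?_⟩
    · intro x hx t h0 h1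
      exact csInf_le hbdd ⟨x, hx.1, t, h0, h1, rfl⟩
    · rintro x ⟨hxV, hxb⟩
      have hxB := hWB hVW hxV
      have hx₀B := hWB hVW hx₀
      rw [mem_ball] at hxb
      have h1 := h.cvx x hxB (g x q t₀) (hgB _ hxB _ hq _ ht0.le ht1) q hq
        x₀ hx₀B (g x₀ q t₀) (hgB _ hx₀B _ hq _ ht0.le ht1) q hq t₀ ht0.le ht1
        (hg1 _ hxB _ hq _ ht0.le ht1) (hg2 _ hxB _ hq _ ht0.le ht1)
        (hg1 _ hx₀B _ hq _ ht0.le ht1) (hg2 _ hx₀B _ hq _ ht0.le ht1)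
      rw [dist_self, mul_zero, add_zero] at h1
      have h2 := dist_triangle a (g x₀ q t₀) (g x q t₀)
      have h3 := dist_triangle a x x₀
      rw [dist_comm (g x₀ q t₀)] at h2
      have h4 : (1 - t₀) * dist x x₀ ≤ dist x x₀ := by nlinarith [dist_nonneg (x := x) (y := x₀)]
      rw [div_le_iff₀ ht0]
      have h5 : v * t₀ = dist a (g x₀ q t₀) - dist a x₀ := by rw [hvdef]; field_simp
      nlinarith
  set μ := ε * r / 8 with hμ
  have hμ0 : 0 < μ := by positivity
  have step3 : ∀ T : Finset X, (∀ q ∈ T, q ∈ closedBall p r) → ∀ V ⊆ W, IsOpen V → V.Nonempty →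
      ∃ V' ⊆ V, IsOpen V' ∧ V'.Nonempty ∧ ∀ q ∈ T, ∃ e t₀ : ℝ, 0 < t₀ ∧ t₀ ≤ 1 ∧
        (∀ x ∈ V', ∀ t, 0 < t → t ≤ 1 → e ≤ (dist a (g x q t) - dist a x) / t) ∧
        ∀ x ∈ V', (dist a (g x q t₀) - dist a x) / t₀ ≤ e + μ := by
    classical
    intro T
    induction T using Finset.induction_on with
    | empty => intro _ V _ hVo hVn; exact ⟨V, subset_rfl, hVo, hVn, by simp⟩
    | insert q T hqT ih =>
      intro hT V hVW hVo hVn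
      obtain ⟨V₁, hV₁, hV₁o, hV₁n, hP⟩ := ih (fun q hq => hT q (Finset.mem_insert_of_mem hq)) V hVW hVo hVn
      obtain ⟨V₂, hV₂, hV₂o, hV₂n, e, t₀, ht0, ht1, hA, hB⟩ :=
        step2 q (hT q (Finset.mem_insert_self _ _)) μ hμ0 V₁ (hV₁.trans hVW) hV₁o hV₁n
      refine ⟨V₂, hV₂.trans hV₁, hV₂o, hV₂n, ?_⟩
      intro q' hq'
      rcases Finset.mem_insert.1 hq' with rfl | hq'
      · exact ⟨e, t₀, ht0, ht1, hA, hB⟩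
      · obtain ⟨e, t₀, ht0, ht1, hA, hB⟩ := hP q' hq'
        exact ⟨e, t₀, ht0, ht1, fun x hx => hA x (hV₂ hx), fun x hx => hB x (hV₂ hx)⟩
  obtain ⟨T, hTB, hTf, hTc⟩ := h.cpt.finite_cover_balls hμ0
  obtain ⟨w₀, hw₀⟩ := hWn
  obtain ⟨V, hVs, hVo, hVn, hP⟩ := step3 hTf.toFinset (fun q hq => hTB (hTf.mem_toFinset.1 hq))
    (W ∩ ball w₀ (μ/2)) inter_subset_left (hWo.inter isOpen_ball) ⟨w₀, hw₀, mem_ball_self (by positivity)⟩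
  have hVW : V ⊆ W := hVs.trans inter_subset_left
  refine ⟨V, hVW, hVo, hVn, ?_⟩
  intro x hx y hy z hz hb
  rcases (dist_nonneg (x := x) (y := y)).eq_or_lt with hA0 | hA0
  · have : x = y := dist_eq_zero.1 hA0.symm
    subst this; simp
  rcases (dist_nonneg (x := y) (y := z)).eq_or_lt with hB0 | hB0
  · have : y = z := dist_eq_zero.1 hB0.symm
    subst this; simp
  have hxB := hWB hVW hx
  have hyB := hWB hVW hy
  have hzB := hWB hVW hz
  have hhalf : ∀ w ∈ V, w ∈ closedBall p (r/2) := fun w hw => by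
    have := hWs (hVW hw)
    rw [mem_ball] at this; rw [mem_closedBall]; linarith
  have hxz4 : dist x z ≤ r / 4 := by
    have h1 := hWs (hVW hx)
    have h2 := hWs (hVW hz)
    rw [mem_ball] at h1 h2
    have := dist_triangle_right x z p
    linarith
  have hxzμ : dist x z ≤ μ := by
    have h1 := (hVs hx).2
    have h2 := (hVs hz).2
    rw [mem_ball] at h1 h2
    have := dist_triangle_right x z w₀
    linarith
  have hxz : x ≠ z := by
    intro e; rw [← e, dist_self] at hb; linarith [dist_nonneg (x := y) (y := x)]
  obtain ⟨Z, hZB, hZ1, hZ2⟩ := h.extL (hhalf x hx) (hhalf z hz) hxz (L := r/2) (by linarith) le_rfl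
  obtain ⟨q, hqT, hZq⟩ : ∃ q ∈ T, dist Z q < μ := by
    have := hTc hZB
    simpa using this
  have hqB := hTB hqT
  obtain ⟨e, t₀, ht0, ht1, hlow, hup⟩ := hP q (hTf.mem_toFinset.2 hqT)
  have hyZ : dist y Z = r / 2 - dist x y := by
    linarith [dist_triangle x y Z, dist_triangle y z Z]
  -- comparison of Z and q
  have hcmp : ∀ w ∈ V, ∀ t, 0 < t → t ≤ 1 → dist (g w Z t) (g w q t) ≤ t * μ := by
    intro w hw t h0 h1
    have hwB := hWB hVW hw
    have := h.cvx w hwB (g w Z t) (hgB _ hwB _ hZB _ h0.le h1) Z hZB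
        w hwB (g w q t) (hgB _ hwB _ hqB _ h0.le h1) q hqB t h0.le h1
        (hg1 _ hwB _ hZB _ h0.le h1) (hg2 _ hwB _ hZB _ h0.le h1)
        (hg1 _ hwB _ hqB _ h0.le h1) (hg2 _ hwB _ hqB _ h0.le h1)
    rw [dist_self, mul_zero, zero_add] at this
    exact this.trans (mul_le_mul_of_nonneg_left hZq.le h0.le)
  -- F1
  have hF1 : e * dist x y ≤ (dist a y - dist a x) * (r / 2) + dist x y * μ := by
    obtain ⟨t₁, ht₁⟩ : ∃ t₁, t₁ = dist x y / (r / 2) := ⟨_, rfl⟩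
    have ht₁0 : 0 < t₁ := by rw [ht₁]; positivity
    have ht₁1 : t₁ ≤ 1 := by
      rw [ht₁, div_le_one (by positivity)]; linarith
    have ht₁r : t₁ * (r / 2) = dist x y := by rw [ht₁]; field_simp
    have hyg : y = g x Z t₁ := by
      have := h.cvx x hxB y hyB Z hZB
        x hxB (g x Z t₁) (hgB _ hxB _ hZB _ ht₁0.le ht₁1) Z hZB t₁ ht₁0.le ht₁1
        (by rw [hZ1, ht₁r]) (by rw [hZ1, hyZ, ← ht₁r]; ring)
        (hg1 _ hxB _ hZB _ ht₁0.le ht₁1) (hg2 _ hxB _ hZB _ ht₁0.le ht₁1)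
      rw [dist_self, dist_self, mul_zero, mul_zero, add_zero] at this
      exact dist_le_zero.1 this
    have h1 := hlow x hx t₁ ht₁0 ht₁1
    rw [le_div_iff₀ ht₁0] at h1
    have h2 := hcmp x hx t₁ ht₁0 ht₁1
    rw [← hyg] at h2
    have h3 := dist_triangle a y (g x q t₁)
    have h4 : e * t₁ ≤ dist a y - dist a x + t₁ * μ := by linarith
    have := mul_le_mul_of_nonneg_right h4 (by linarith : (0:ℝ) ≤ r / 2)
    rw [← ht₁r]
    linarith
  have hl : dist z Z = r / 2 - (dist x y + dist y z) := by linarith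
  have hF2 : (dist a z - dist a y) * dist z Z ≤ (e + 2 * μ) * dist y z := by
    have h1 := hup z hz
    rw [div_le_iff₀ ht0] at h1
    have h2 := hcmp z hz t₀ ht0 ht1
    have h3 := dist_triangle a (g z q t₀) (g z Z t₀)
    rw [dist_comm (g z q t₀)] at h3
    have hmB := hgB _ hzB _ hZB _ ht0.le ht1
    have e1 := hg1 _ hzB _ hZB _ ht0.le ht1
    have e2 := hg2 _ hzB _ hZB _ ht0.le ht1
    have e3 : dist y (g z Z t₀) = dist y z + dist z (g z Z t₀) := by
      have := dist_triangle y (g z Z t₀) Z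
      have := dist_triangle y z (g z Z t₀)
      linarith
    have h4 := h.cvx1 ha hyB hzB hmB e3
    rw [e3, e1] at h4
    have h5 : dist a (g z Z t₀) - dist a z ≤ (e + 2 * μ) * t₀ := by linarith
    have h6 := mul_le_mul_of_nonneg_right h5 hB0.le
    have : t₀ * ((dist a z - dist a y) * dist z Z) ≤ t₀ * ((e + 2 * μ) * dist y z) := by
      nlinarith
    exact le_of_mul_le_mul_left this ht0
  have hu : dist a z - dist a y ≤ dist y z := by linarith [dist_triangle a y z]
  have h7 : (dist a z - dist a y) * (r / 2) ≤ (e + 2 * μ) * dist y z + dist y z * μ := by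
    rw [hl] at hF2
    have : (dist a z - dist a y) * (dist x y + dist y z) ≤ dist y z * μ := by
      calc _ ≤ dist y z * (dist x y + dist y z) := mul_le_mul_of_nonneg_right hu (by positivity)
        _ ≤ _ := mul_le_mul_of_nonneg_left (by linarith) hB0.le
    linarith
  have h8 := mul_le_mul_of_nonneg_right h7 hA0.le
  have h9 := mul_le_mul_of_nonneg_right hF1 hB0.le
  have h10 : (r / 2) * ((dist a z - dist a y) * dist x y) ≤
      (r / 2) * ((dist a y - dist a x) * dist y z + ε * dist x y * dist y z) := by
    have : 4 * μ = ε * (r / 2) := by rw [hμ]; ring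
    have h11 : 4 * μ * (dist x y * dist y z) = ε * (r / 2) * (dist x y * dist y z) := by rw [this]
    linarith
  exact le_of_mul_le_mul_left h10 (by linarith)

/-- strainers of length `k` on `W` -/
structure Str (p : X) (r ε : ℝ) (k : ℕ) (a : ℕ → X) (W : Set X) : Prop where
  opn : IsOpen W
  ne : W.Nonempty
  sub : W ⊆ ball p (r/8)
  mem : ∀ i < k, a i ∈ ball p (r/8)
  nmem : ∀ i < k, a i ∉ W
  aff : ∀ i < k, Aff (a i) ε W
  orth : ∀ i < k, ∀ j < i, ∀ x ∈ W, ∀ m ∈ W, dist x (a i) = dist x m + dist m (a i) →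
    |dist (a j) m - dist (a j) x| ≤ 2 * ε * dist x m

theorem Good.small (h : Good p r) {x : X} (hx : x ∈ ball p (r/8)) : x ∈ closedBall p r := by
  have := h.pos
  rw [mem_ball] at hx; rw [mem_closedBall]; linarith

theorem Good.half (h : Good p r) {x : X} (hx : x ∈ ball p (r/8)) : x ∈ closedBall p (r/2) := by
  have := h.pos
  rw [mem_ball] at hx; rw [mem_closedBall]; linarith

theorem dist_lt_quarter {x y : X} (hx : x ∈ ball p (r/8)) (hy : y ∈ ball p (r/8)) :
    dist x y < r / 4 := by
  rw [mem_ball] at hx hy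
  linarith [dist_triangle_right x y p]

/-- moving towards `a i` -/
theorem Str.toward (h : Good p r) {ε : ℝ} {k : ℕ} {a : ℕ → X} {W : Set X}
    (S : Str p r ε k a W) {x : X} {s ρ : ℝ} (hρ : ball x ρ ⊆ W) (hx : x ∈ W) (hs : 0 < s)
    (hsρ : s < ρ) {i : ℕ} (hi : i < k) :
    ∃ m ∈ W, dist x m = s ∧ dist x (a i) = dist x m + dist m (a i) := by
  have hle : s ≤ dist x (a i) := by
    by_contra hlt
    push Not at hlt
    apply S.nmem i hi
    apply hρ
    rw [mem_ball, dist_comm]; linarith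
  obtain ⟨m, hm, h1, h2⟩ := h.geoL (h.small (S.sub hx)) (h.small (S.mem i hi)) hs.le hle
  exact ⟨m, hρ (by rw [mem_ball, dist_comm]; linarith), h1, by linarith⟩

theorem Good.bound (h : Good p r) : ∃ N : ℕ, ∀ (ε : ℝ) (k : ℕ) (a : ℕ → X) (W : Set X),
    ε ≤ 1/4 → Str p r ε k a W → k ≤ N := by
  have hr := h.pos
  obtain ⟨T, hTB, hTf, hTc⟩ := h.cpt.finite_cover_balls (show 0 < r / 8 by linarith)
  refine ⟨hTf.toFinset.card, ?_⟩
  intro ε k a W hε S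
  obtain ⟨x, hx⟩ := S.ne
  obtain ⟨ρ, hρ, hρW⟩ := Metric.isOpen_iff.1 S.opn x hx
  set s := ρ / 2 with hs
  have hs0 : 0 < s := by positivity
  have hpt : ∀ i : Fin k, ∃ Z ∈ closedBall p r, ∃ m ∈ W, dist x m = s ∧
      dist x (a i) = dist x m + dist m (a i) ∧ dist x Z = r / 2 ∧ dist x Z = dist x m + dist m Z := by
    intro i
    obtain ⟨m, hm, h1, h2⟩ := S.toward h hρW hx hs0 (by linarith) i.2
    have hne : x ≠ m := by
      intro e; rw [e, dist_self] at h1; linarith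
    have := dist_lt_quarter (S.sub hx) (S.sub hm)
    obtain ⟨Z, hZ, h3, h4⟩ := h.extL (h.half (S.sub hx)) (h.half (S.sub hm)) hne (L := r/2)
      (by linarith) le_rfl
    exact ⟨Z, hZ, m, hm, h1, h2, h3, h4⟩
  choose Z hZ m hm h1 h2 h3 h4 using hpt
  have hsep : ∀ i j : Fin k, j < i → r / 4 ≤ dist (Z i) (Z j) := by
    intro i j hji
    have o := S.orth i i.2 j hji x hx (m i) (hm i) (h2 i)
    rw [h1] at o
    have o' := (abs_le.1 o).1
    have e1 := h2 j
    rw [h1, dist_comm x, dist_comm (m j)] at e1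
    have e2 := dist_triangle (a j) (m j) (m i)
    have e3 : 2 * ε * s ≤ s / 2 := by nlinarith
    have e4 : s / 2 ≤ dist (m i) (m j) := by rw [dist_comm (m i)]; linarith
    have hs4 : s < r / 4 := by
      have := dist_lt_quarter (S.sub hx) (S.sub (hm i))
      rw [h1] at this; exact this
    have e5 := h.cvx x (h.small (S.sub hx)) (m i) (h.small (S.sub (hm i))) (Z i) (hZ i)
      x (h.small (S.sub hx)) (m j) (h.small (S.sub (hm j))) (Z j) (hZ j) (s / (r / 2)) (by positivity)
      (by rw [div_le_one (by linarith)]; linarith)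
      (by rw [h1, h3]; field_simp)
      (by have := h4 i; rw [h1] at this; rw [h3] at this ⊢; field_simp; linarith)
      (by rw [h1, h3]; field_simp)
      (by have := h4 j; rw [h1] at this; rw [h3] at this ⊢; field_simp; linarith)
    rw [dist_self, mul_zero, zero_add] at e5
    have e6 : s / 2 ≤ s / (r / 2) * dist (Z i) (Z j) := e4.trans e5
    have e7 : s / (r / 2) * (r / 4) ≤ s / (r / 2) * dist (Z i) (Z j) := by
      have : s / (r / 2) * (r / 4) = s / 2 := by field_simp; norm_num
      rw [this]; exact e6
    exact le_of_mul_le_mul_left e7 (by positivity)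
  have hq : ∀ i : Fin k, ∃ q ∈ T, dist (Z i) q < r / 8 := by
    intro i
    have := hTc (hZ i)
    simpa using this
  choose q hqT hq using hq
  have hinj : Function.Injective q := by
    have aux : ∀ i j : Fin k, j < i → q i ≠ q j := by
      intro i j hji e
      have e1 := hsep i j hji
      have e2 := hq i
      have e3 := hq j
      rw [← e] at e3
      linarith [dist_triangle_right (Z i) (Z j) (q i)]
    intro i j e
    rcases lt_trichotomy i j with hlt | heq | hgt
    · exact absurd e.symm (aux j i hlt)
    · exact heq
    · exact absurd e (aux i j hgt)
  have := Finset.card_le_card_of_injOn (s := Finset.univ) (t := hTf.toFinset) q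
    (fun i _ => by simpa using hqT i) hinj.injOn
  simpa using this

theorem Str.extend (h : Good p r) {ε : ℝ} (hε : 0 < ε) (hε1 : ε ≤ 1) {k : ℕ} {a : ℕ → X} {W : Set X}
    (S : Str p r ε k a W) {x y : X} (hx : x ∈ W) (hy : y ∈ W) (hxy : x ≠ y)
    (hf : ∀ j < k, dist (a j) x = dist (a j) y) :
    ∃ (a' : ℕ → X), ∃ W' ⊆ W, Str p r ε (k+1) a' W' := by
  have hl : 0 < dist x y := dist_pos.2 hxy
  set l := dist x y with hldef
  obtain ⟨W', hW's, hW'o, hW'n, hW'a⟩ := h.exists_aff (a := x) (h.small (S.sub hx)) hε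
    (W := W ∩ ball y (ε / 2 * l)) (S.opn.inter isOpen_ball)
    ⟨y, hy, mem_ball_self (by positivity)⟩ (inter_subset_left.trans S.sub)
  have hW'W : W' ⊆ W := hW's.trans inter_subset_left
  have hn : ∀ i < k, Function.update a k x i = a i := fun i hi =>
    Function.update_of_ne (by omega) _ _
  have hk : Function.update a k x k = x := Function.update_self _ _ _
  refine ⟨Function.update a k x, W', hW'W, hW'o, hW'n, hW'W.trans S.sub, ?_, ?_, ?_, ?_⟩
  · intro i hi
    rcases Nat.lt_succ_iff_lt_or_eq.1 hi with hi | rfl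
    · rw [hn i hi]; exact S.mem i hi
    · rw [hk]; exact S.sub hx
  · intro i hi
    rcases Nat.lt_succ_iff_lt_or_eq.1 hi with hi | rfl
    · rw [hn i hi]; exact fun hm => S.nmem i hi (hW'W hm)
    · rw [hk]
      intro hm
      have := (hW's hm).2
      rw [mem_ball] at this
      nlinarith
  · intro i hi
    rcases Nat.lt_succ_iff_lt_or_eq.1 hi with hi | rfl
    · rw [hn i hi]; exact (S.aff i hi).mono hW'W
    · rw [hk]; exact hW'a
  · intro i hi j hji z hz m hm hb
    rcases Nat.lt_succ_iff_lt_or_eq.1 hi with hi | rfl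
    · rw [hn i hi] at hb
      rw [hn j (hji.trans hi)]
      exact S.orth i hi j hji z (hW'W hz) m (hW'W hm) hb
    · rw [hk] at hb
      rw [hn j hji]
      have hzy := (hW's hz).2
      have hmy := (hW's hm).2
      rw [mem_ball] at hzy hmy
      have hA := S.aff j hji z (hW'W hz) m (hW'W hm) x hx hb
      have hC := h.cvx1 (h.small (S.mem j hji)) (h.small (S.sub (hW'W hz)))
        (h.small (S.sub (hW'W hm))) (h.small (S.sub hx)) hb
      have hfj := hf j hji
      set A := dist (a j) z
      set M := dist (a j) m
      set F := dist (a j) x with hF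
      have hzl : l / 2 ≤ dist z x := by
        have := dist_triangle_left x y z
        change l ≤ _ at this
        nlinarith
      have hFA : |F - A| ≤ ε / 2 * l := by
        rw [hfj]
        have h1 := dist_triangle (a j) y z
        have h2 := dist_triangle (a j) z y
        rw [dist_comm y z] at h1
        rw [abs_le]
        constructor <;> linarith
      have hmx : 0 < dist m x := by
        refine lt_of_lt_of_le ?_ (by
          have := dist_triangle_left x y m
          change l ≤ _ at this
          linarith : l - dist m y ≤ dist m x)
        nlinarith
      have hD := dist_nonneg (x := z) (y := m)
      set s := dist z m with hs
      set u := dist m x with hu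
      rw [hb] at hzl hC
      obtain ⟨f1, f2⟩ := abs_le.1 hFA
      have hFA' : ε / 2 * l ≤ ε * (s + u) := by nlinarith
      have k1 : (F - A) * s ≤ ε * (s + u) * s := mul_le_mul_of_nonneg_right (by linarith) hD
      have k2 : -(ε * (s + u)) * s ≤ (F - A) * s := mul_le_mul_of_nonneg_right (by linarith) hD
      have hsu : 0 < s + u := by linarith
      rw [abs_le]
      constructor
      · -- (M-A)(s+u) ≥ (F-A)s - ε s u
        have : (s + u) * (-(2 * ε * s)) ≤ (s + u) * (M - A) := by nlinarith [mul_nonneg hD hD, mul_nonneg hε.le (mul_nonneg hD hD)]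
        exact le_of_mul_le_mul_left this hsu
      · have : (s + u) * (M - A) ≤ (s + u) * (2 * ε * s) := by
          nlinarith [mul_nonneg hε.le (mul_nonneg hD hD), mul_nonneg hε.le (mul_nonneg hD hmx.le)]
        exact le_of_mul_le_mul_left this hsu

/-- moving one coordinate -/
theorem Str.move (h : Good p r) {ε : ℝ} (hε : 0 < ε) {k : ℕ} {a : ℕ → X} {W : Set X}
    (S : Str p r ε k a W) {x : X} {s ρ : ℝ} (hρ : ball x ρ ⊆ W) (hx : x ∈ W) (hs : 0 < s)
    (hsρ : s < ρ) (hsr : s ≤ r / 4) {i : ℕ} (hi : i < k) {v : ℝ} (hv : s ≤ |dist (a i) x - v|) :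
    ∃ y, dist x y = s ∧ |dist (a i) y - v| = |dist (a i) x - v| - s ∧
      ∀ j < i, |dist (a j) y - dist (a j) x| ≤ 3 * ε * s := by
  obtain ⟨m, hm, h1, h2⟩ := S.toward h hρ hx hs hsρ hi
  have ho : ∀ j < i, |dist (a j) m - dist (a j) x| ≤ 2 * ε * s := fun j hj => by
    have := S.orth i hi j hj x hx m hm h2
    rwa [h1] at this
  rcases le_total v (dist (a i) x) with hle | hle
  · refine ⟨m, h1, ?_, fun j hj => (ho j hj).trans (by nlinarith)⟩
    rw [abs_of_nonneg (sub_nonneg.2 hle)] at hv ⊢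
    rw [h1, dist_comm x, dist_comm m] at h2
    rw [abs_of_nonneg (by linarith)]
    linarith
  · have hne : a i ≠ x := fun e => S.nmem i hi (e ▸ hx)
    have := dist_lt_quarter (S.mem i hi) (S.sub hx)
    obtain ⟨y, hy, h3, h4⟩ := h.extL (h.half (S.mem i hi)) (h.half (S.sub hx)) hne
      (L := dist (a i) x + s) (by linarith) (by linarith)
    have h5 : dist x y = s := by linarith
    have hyW : y ∈ W := hρ (by rw [mem_ball, dist_comm]; linarith)
    have h2' := h2
    rw [dist_comm x, dist_comm m, h1] at h2'
    have hb : dist m y = dist m x + dist x y := by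
      have e1 := dist_triangle m x y
      have e2 := dist_triangle (a i) m y
      rw [dist_comm m x] at e1 ⊢
      linarith
    refine ⟨y, h5, ?_, ?_⟩
    · rw [abs_of_nonpos (sub_nonpos.2 hle)] at hv ⊢
      rw [abs_of_nonpos (by linarith)]
      linarith
    · intro j hj
      have hA := S.aff j (hj.trans hi) m hm x hx y hyW hb
      have hC := h.cvx1 (h.small (S.mem j (hj.trans hi))) (h.small (S.sub hm))
        (h.small (S.sub hx)) hy hb
      rw [hb, dist_comm m x, h1, h5] at hC
      rw [dist_comm m x, h1, h5] at hA
      obtain ⟨o1, o2⟩ := abs_le.1 (ho j hj)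
      have q1 : dist (a j) y - dist (a j) x ≤ dist (a j) x - dist (a j) m + ε * s := by
        refine le_of_mul_le_mul_right ?_ hs
        linarith
      have q2 : dist (a j) x - dist (a j) m ≤ dist (a j) y - dist (a j) x := by
        refine le_of_mul_le_mul_right ?_ hs
        linarith
      rw [abs_le]
      constructor <;> nlinarith

theorem weight_sum (η : ℝ) (hη : 0 ≤ η) (i k : ℕ) (hik : i < k) :
    ∑ j ∈ Finset.range k, (1/3:ℝ)^j * (if j < i then η else if j = i then -1 else 1) ≤
      k * η - (3/2) * (1/3:ℝ)^k := by
  induction k, hik using Nat.le_induction with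
  | base =>
    rw [Finset.sum_range_succ]
    have : ∑ j ∈ Finset.range i, (1/3:ℝ)^j * (if j < i then η else if j = i then -1 else 1) ≤
        ∑ j ∈ Finset.range i, η := by
      apply Finset.sum_le_sum
      intro j hj
      rw [if_pos (Finset.mem_range.1 hj)]
      have : (1/3:ℝ)^j ≤ 1 := pow_le_one₀ (by norm_num) (by norm_num)
      nlinarith
    simp only [lt_irrefl, if_false, if_true]
    rw [Finset.sum_const, Finset.card_range, nsmul_eq_mul] at this
    have h3 : (0:ℝ) < (1/3)^i := by positivity
    rw [Nat.succ_eq_add_one, pow_succ]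
    push_cast
    linarith
  | succ k hk ih =>
    rw [Finset.sum_range_succ]
    have h1 : ¬ k < i := by omega
    have h2 : ¬ k = i := by omega
    rw [if_neg h1, if_neg h2, pow_succ]
    push_cast
    linarith

theorem Str.open (h : Good p r) {ε : ℝ} (hε : 0 < ε) {k : ℕ} {a : ℕ → X} {W : Set X}
    (S : Str p r ε k a W) (hεk : 3 * ε * k ≤ (1/2) * (1/3:ℝ)^k)
    {x₀ : X} {δ : ℝ} (hδ : 0 < δ) (hδW : closedBall x₀ δ ⊆ W) :
    ∃ τ > 0, ∀ v : ℕ → ℝ, (∀ i < k, |dist (a i) x₀ - v i| < τ) →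
      ∃ x ∈ closedBall x₀ δ, ∀ i < k, dist (a i) x = v i := by
  have hr := h.pos
  set c : ℝ := (1/2) * (1/3:ℝ)^k with hc
  have hc0 : 0 < c := by positivity
  have hcpt : IsCompact (closedBall x₀ δ) :=
    h.cpt.of_isClosed_subset isClosed_closedBall (hδW.trans fun x hx => h.small (S.sub hx))
  refine ⟨c * δ / (k + 1), by positivity, ?_⟩
  intro v hv
  set Φ : X → ℝ := fun x => ∑ j ∈ Finset.range k, (1/3:ℝ)^j * |dist (a j) x - v j| with hΦ
  have hΦ0 : Φ x₀ < c * δ := by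
    have h1 : Φ x₀ ≤ ∑ j ∈ Finset.range k, c * δ / (k + 1) := by
      apply Finset.sum_le_sum
      intro j hj
      have h2 : (1/3:ℝ)^j ≤ 1 := pow_le_one₀ (by norm_num) (by norm_num)
      have h3 := hv j (Finset.mem_range.1 hj)
      nlinarith [abs_nonneg (dist (a j) x₀ - v j)]
    rw [Finset.sum_const, Finset.card_range, nsmul_eq_mul] at h1
    have : (k:ℝ) * (c * δ / (k + 1)) < c * δ := by
      rw [mul_div_assoc', div_lt_iff₀ (by positivity)]
      nlinarith [mul_pos hc0 hδ]
    linarith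
  have hΦnn : ∀ x, 0 ≤ Φ x := fun x => Finset.sum_nonneg fun j _ => by positivity
  obtain ⟨x, hxB, hmin⟩ := hcpt.exists_isMinOn ⟨x₀, mem_closedBall_self hδ.le⟩
    (f := fun x => Φ x + c * dist x x₀) (by simp only [hΦ]; fun_prop)
  have hx1 : Φ x + c * dist x x₀ ≤ Φ x₀ + c * dist x₀ x₀ := hmin (mem_closedBall_self hδ.le)
  rw [dist_self, mul_zero, add_zero] at hx1
  have hxδ : dist x x₀ < δ := by
    have : c * dist x x₀ < c * δ := by linarith [hΦnn x]
    exact lt_of_mul_lt_mul_left this hc0.le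
  refine ⟨x, hxB, ?_⟩
  by_contra hcon
  push Not at hcon
  obtain ⟨i, hi, hne⟩ := hcon
  have hpos : 0 < |dist (a i) x - v i| := abs_pos.2 (sub_ne_zero.2 hne)
  have hroom : 0 < δ - dist x x₀ := by linarith
  have hball : ball x (δ - dist x x₀) ⊆ closedBall x₀ δ := fun y hy => by
    rw [mem_ball] at hy; rw [mem_closedBall]
    linarith [dist_triangle y x x₀]
  obtain ⟨s, hs, hs1, hs2, hs3⟩ : ∃ s > 0, s < δ - dist x x₀ ∧ s ≤ r / 4 ∧ s ≤ |dist (a i) x - v i| := by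
    refine ⟨min ((δ - dist x x₀) / 2) (min (r / 4) |dist (a i) x - v i|), by positivity, ?_, by simp, by simp⟩
    exact (min_le_left _ _).trans_lt (by linarith)
  obtain ⟨y, hy1, hy2, hy3⟩ := S.move h hε (hball.trans hδW) (hδW hxB) hs hs1 hs2 hi hs3
  have hyB : y ∈ closedBall x₀ δ := hball (by rw [mem_ball, dist_comm]; linarith)
  have hy4 : Φ x + c * dist x x₀ ≤ Φ y + c * dist y x₀ := hmin hyB
  have hy5 : Φ y - Φ x ≤ s * (k * (3 * ε) - (3/2) * (1/3:ℝ)^k) := by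
    refine le_trans ?_ (mul_le_mul_of_nonneg_left (weight_sum (3 * ε) (by positivity) i k hi) hs.le)
    simp only [hΦ]
    rw [← Finset.sum_sub_distrib, Finset.mul_sum]
    apply Finset.sum_le_sum
    intro j hj
    rw [← mul_sub, mul_left_comm]
    apply mul_le_mul_of_nonneg_left _ (by positivity)
    have t1 : |dist (a j) y - v j| ≤ |dist (a j) y - dist (a j) x| + |dist (a j) x - v j| :=
      abs_sub_le _ _ _
    split_ifs with hji hji'
    · have := hy3 j hji
      linarith
    · subst hji'
      rw [hy2]; linarith
    · have : |dist (a j) y - dist (a j) x| ≤ s := by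
        rw [← hy1, dist_comm (a j), dist_comm (a j), dist_comm x y]
        exact abs_dist_sub_le _ _ _
      linarith
  have hy6 := dist_triangle_left y x₀ x
  rw [hy1] at hy6
  have hy7 : c * dist y x₀ ≤ c * s + c * dist x x₀ := by nlinarith
  have hy8 : s * (k * (3 * ε) - (3/2) * (1/3:ℝ)^k) ≤ s * (-(2 * c)) :=
    mul_le_mul_of_nonneg_left (by linarith) hs.le
  nlinarith [mul_pos hs hc0]

theorem Str.manifold (h : Good p r) {ε : ℝ} (hε : 0 < ε) {k : ℕ} {a : ℕ → X} {W : Set X}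
    (S : Str p r ε k a W) (hεk : 3 * ε * k ≤ (1/2) * (1/3:ℝ)^k)
    (hinj : ∀ x ∈ W, ∀ y ∈ W, (∀ j < k, dist (a j) x = dist (a j) y) → x = y) :
    ∃ x ∈ W, ∃ U : Set X, IsOpen U ∧ x ∈ U ∧ Nonempty (U ≃ₜ EuclideanSpace ℝ (Fin k)) := by
  obtain ⟨x₀, hx₀⟩ := S.ne
  set f : W → EuclideanSpace ℝ (Fin k) := fun x => WithLp.toLp 2 fun i : Fin k => dist (a i) x with hf
  have hfc : Continuous f := by
    rw [hf]
    exact (PiLp.continuous_toLp 2 _).comp (continuous_pi fun i => by fun_prop)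
  have hfi : Function.Injective f := by
    intro x y hxy
    apply Subtype.ext
    apply hinj x x.2 y y.2
    intro j hj
    have := congrArg (fun w : EuclideanSpace ℝ (Fin k) => w ⟨j, hj⟩) hxy
    simpa [hf] using this
  have hfo : IsOpenMap f := by
    rw [isOpenMap_iff_nhds_le]
    intro x s hs
    rw [Filter.mem_map] at hs
    obtain ⟨δ, hδ, hδs⟩ := Metric.mem_nhds_iff.1 hs
    obtain ⟨ρ, hρ, hρW⟩ := Metric.isOpen_iff.1 S.opn x x.2
    obtain ⟨δ', hδ', h1, h2⟩ : ∃ δ' > 0, δ' < δ ∧ δ' < ρ :=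
      ⟨min δ ρ / 2, by positivity, by
        have := min_le_left δ ρ
        have : 0 < min δ ρ := lt_min hδ hρ
        linarith, by
        have := min_le_right δ ρ
        have : 0 < min δ ρ := lt_min hδ hρ
        linarith⟩
    have hsub : closedBall (x:X) δ' ⊆ W := (closedBall_subset_ball h2).trans hρW
    obtain ⟨τ, hτ, hsol⟩ := S.open h hε hεk hδ' hsub
    rw [Metric.mem_nhds_iff]
    refine ⟨τ, hτ, ?_⟩
    intro w hw
    obtain ⟨y, hyB, hy⟩ := hsol (fun j => if hj : j < k then w ⟨j, hj⟩ else 0) (by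
      intro i hi
      rw [dif_pos hi]
      rw [mem_ball, dist_comm, dist_eq_norm] at hw
      have := PiLp.norm_apply_le (f x - w) ⟨i, hi⟩
      rw [Real.norm_eq_abs] at this
      exact lt_of_le_of_lt (by simpa [hf] using this) hw)
    have hyW : y ∈ W := hsub hyB
    have hmem : (⟨y, hyW⟩ : W) ∈ ball x δ := by
      rw [mem_ball]; exact lt_of_le_of_lt hyB h1
    have hfy : f ⟨y, hyW⟩ = w := by
      ext i
      have := hy i i.2
      rw [dif_pos i.2] at this
      simpa [hf] using this
    have := hδs hmem
    rw [mem_preimage, hfy] at this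
    exact this
  have hemb : Topology.IsOpenEmbedding f := .of_continuous_injective_isOpenMap hfc hfi hfo
  -- a ball in the image
  set w₀ := f ⟨x₀, hx₀⟩
  obtain ⟨δ, hδ, hδs⟩ := Metric.isOpen_iff.1 hemb.isOpen_range w₀ ⟨_, rfl⟩
  set e := OpenPartialHomeomorph.univBall w₀ δ with he
  have het : e.target = ball w₀ δ := OpenPartialHomeomorph.univBall_target w₀ hδ
  have hes : e.source = univ := OpenPartialHomeomorph.univBall_source w₀ δ
  have hec : Topology.IsOpenEmbedding e := e.isOpenEmbedding hes
  have herange : range e = ball w₀ δ := by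
    rw [← image_univ, ← hes, e.image_source_eq_target, het]
  refine ⟨x₀, hx₀, Subtype.val '' (f ⁻¹' ball w₀ δ), ?_, ?_, ?_⟩
  · exact S.opn.isOpenMap_subtype_val _ (isOpen_ball.preimage hfc)
  · exact ⟨⟨x₀, hx₀⟩, mem_ball_self hδ, rfl⟩
  · have e1 : (f ⁻¹' ball w₀ δ) ≃ₜ (Subtype.val '' (f ⁻¹' ball w₀ δ) : Set X) :=
      Topology.IsEmbedding.subtypeVal.homeomorphImage _
    have e2 : (f ⁻¹' ball w₀ δ) ≃ₜ (f '' (f ⁻¹' ball w₀ δ)) := hemb.isEmbedding.homeomorphImage _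
    have e3 : f '' (f ⁻¹' ball w₀ δ) = range e := by
      rw [herange, image_preimage_eq_of_subset hδs]
    exact ⟨e1.symm.trans (e2.trans ((Homeomorph.setCongr e3).trans hec.isEmbedding.toHomeomorph.symm))⟩

theorem dense_aux (hX : IsGNPC X) (O : Set X) (hO : IsOpen O) (hOn : O.Nonempty) :
    ∃ x ∈ O, ∃ n : ℕ, ∃ U : Set X, IsOpen U ∧ x ∈ U ∧
        Nonempty (U ≃ₜ EuclideanSpace ℝ (Fin n)) := by
  obtain ⟨p, hp⟩ := hOn
  obtain ⟨r, h⟩ := exists_good hX p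
  have hr := h.pos
  obtain ⟨N, hN⟩ := h.bound
  obtain ⟨ε, hε, hε4, hεN⟩ : ∃ ε > 0, ε ≤ 1/4 ∧ 3 * ε * N ≤ (1/2) * (1/3:ℝ)^N := by
    have h3 : (0:ℝ) < (1/3:ℝ)^N := by positivity
    have h4 : (1/3:ℝ)^N ≤ 1 := pow_le_one₀ (by norm_num) (by norm_num)
    refine ⟨(1/3:ℝ)^N / (6 * (N + 1)), by positivity, ?_, ?_⟩
    · rw [div_le_iff₀ (by positivity)]
      have : (0:ℝ) ≤ N := by positivity
      linarith
    · have h5 : (N:ℝ) / (N + 1) ≤ 1 := by rw [div_le_one (by positivity)]; linarith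
      calc 3 * ((1/3:ℝ)^N / (6 * (N + 1))) * N = (1/2) * (1/3:ℝ)^N * ((N:ℝ) / (N + 1)) := by
            field_simp; ring
        _ ≤ (1/2) * (1/3:ℝ)^N * 1 := mul_le_mul_of_nonneg_left h5 (by positivity)
        _ = _ := by ring
  have h0 : ∃ (a : ℕ → X), ∃ W ⊆ O, Str p r ε 0 a W :=
    ⟨fun _ => p, O ∩ ball p (r/8), inter_subset_left, hO.inter isOpen_ball,
      ⟨p, hp, mem_ball_self (by linarith)⟩, inter_subset_right, by simp, by simp, by simp, by simp⟩
  obtain ⟨k, ⟨a, W, hWO, S⟩, hk⟩ : ∃ k, (∃ (a : ℕ → X), ∃ W ⊆ O, Str p r ε k a W) ∧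
      ¬ ∃ (a : ℕ → X), ∃ W ⊆ O, Str p r ε (k+1) a W := by
    by_contra hcon
    push Not at hcon
    have hall : ∀ k, ∃ (a : ℕ → X), ∃ W ⊆ O, Str p r ε k a W := by
      intro k
      induction k with
      | zero => exact h0
      | succ k ih => exact hcon k ih
    obtain ⟨a, W, -, S⟩ := hall (N + 1)
    have := hN ε _ a W hε4 S
    omega
  have hkN := hN ε _ a W hε4 S
  have hεk : 3 * ε * k ≤ (1/2) * (1/3:ℝ)^k := by
    have h1 : (k:ℝ) ≤ N := by exact_mod_cast hkN
    have h2 : (1/3:ℝ)^N ≤ (1/3:ℝ)^k := pow_le_pow_of_le_one (by norm_num) (by norm_num) hkN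
    nlinarith
  obtain ⟨x, hx, U, hU⟩ := S.manifold h hε hεk (by
    intro x hx y hy hf
    by_contra hne
    obtain ⟨a', W', hW', S'⟩ := S.extend h hε (by linarith) hx hy hne hf
    exact hk ⟨a', W', hW'.trans hWO, S'⟩)
  exact ⟨x, hWO hx, k, U, hU⟩

end main

end GNPCProof

/-- A GNPC space contains an open dense subset of manifold points
(of possibly different dimensions). -/
theorem gnpc_manifold_points_open_dense
    (X : Type*) [MetricSpace X] (hX : IsGNPC X) :
    IsOpen {x : X | ∃ n : ℕ, ∃ U : Set X, IsOpen U ∧ x ∈ U ∧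
        Nonempty (U ≃ₜ EuclideanSpace ℝ (Fin n))} ∧
      Dense {x : X | ∃ n : ℕ, ∃ U : Set X, IsOpen U ∧ x ∈ U ∧
        Nonempty (U ≃ₜ EuclideanSpace ℝ (Fin n))} := by
  constructor
  · rw [isOpen_iff_forall_mem_open]
    rintro x ⟨n, U, hU, hx, e⟩
    exact ⟨U, fun y hy => ⟨n, U, hU, hy, e⟩, hU, hx⟩
  · rw [dense_iff_inter_open]
    intro O hO hOn
    obtain ⟨x, hx, hh⟩ := GNPCProof.dense_aux hX O hO hOn
    exact ⟨x, hx, hh⟩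
end

section
/- Let X be a GNPC space and p ∈ X. Then there exists r₀ > 0 such that for all r, s with 0 < r < r₀ and 0 < s < r₀: the metric spheres {x : X | dist p x = r} and {x : X | dist p x = s} are homotopy equivalent, and the sphere {x : X | dist p x = r} is homotopy equivalent to the punctured ball {x : X | 0 < dist p x ∧ dist p x < s}. -/
open Set Metric

namespace GN

variable {Y : Type*} [MetricSpace Y]

theorem conv_le (h : IsBNPC Y) {γ η : ℝ → Y} {x y x' y' : Y} (h1 : IsGeodesic γ x y)
    (h2 : IsGeodesic η x' y') {t : ℝ} (ht : t ∈ Set.Icc (0:ℝ) 1) :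
    dist (γ t) (η t) ≤ (1 - t) * dist x x' + t * dist y y' := by
  have := (h.2.2 γ η x y x' y' h1 h2).2 (Set.left_mem_Icc.2 zero_le_one)
    (Set.right_mem_Icc.2 zero_le_one) (by linarith [ht.2] : 0 ≤ 1 - t) ht.1 (by ring)
  simpa [h1.1, h1.2.1, h2.1, h2.2.1] using this

theorem concat (hY : IsGeodesicSpace Y) (x z y : Y) (t : ℝ) (ht : t ∈ Set.Icc (0:ℝ) 1)
    (h1 : dist x z = t * dist x y) (h2 : dist z y = (1 - t) * dist x y) :
    ∃ γ, IsGeodesic γ x y ∧ γ t = z := by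
  obtain ⟨α, a0, a1, ha⟩ := hY x z
  obtain ⟨β, b0, b1, hb⟩ := hY z y
  rcases eq_or_lt_of_le ht.1 with h0 | h0
  · subst h0
    have : x = z := by simpa using h1
    subst this
    exact ⟨β, ⟨b0, b1, hb⟩, b0⟩
  rcases eq_or_lt_of_le ht.2 with h1' | h1'
  · subst h1'
    have : z = y := by simpa using h2
    subst this
    exact ⟨α, ⟨a0, a1, ha⟩, a1⟩
  set D := dist x y with hD
  have h1t : 0 < 1 - t := by linarith
  set γ : ℝ → Y := fun s => if s ≤ t then α (s / t) else β ((s - t) / (1 - t)) with hγ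
  have g0 : γ 0 = x := by simp [hγ, h0.le, a0]
  have g1 : γ 1 = y := by
    simp only [hγ]; rw [if_neg (by linarith), div_self h1t.ne', b1]
  have gt : γ t = z := by simp [hγ, div_self h0.ne', a1]
  have e1 : ∀ s ∈ Set.Icc 0 t, ∀ s' ∈ Set.Icc 0 t, dist (γ s) (γ s') = |s - s'| * D := by
    intro s hs s' hs'
    simp only [hγ]; rw [if_pos hs.2, if_pos hs'.2, ha _ ⟨by have := hs.1; positivity, by rw [div_le_one h0]; exact hs.2⟩
      _ ⟨by have := hs'.1; positivity, by rw [div_le_one h0]; exact hs'.2⟩, h1, ← sub_div, abs_div, abs_of_pos h0]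
    field_simp
  have gb : ∀ s, t ≤ s → γ s = β ((s - t) / (1 - t)) := by
    intro s hs
    rcases eq_or_lt_of_le hs with h | h
    · subst h; rw [gt]; simp [b0]
    · simp only [hγ]; rw [if_neg (by linarith)]
  have e2 : ∀ s ∈ Set.Icc t 1, ∀ s' ∈ Set.Icc t 1, dist (γ s) (γ s') = |s - s'| * D := by
    intro s hs s' hs'
    rw [gb s hs.1, gb s' hs'.1, hb _ ⟨div_nonneg (by linarith [hs.1]) h1t.le, by rw [div_le_one h1t]; linarith [hs.2]⟩
      _ ⟨div_nonneg (by linarith [hs'.1]) h1t.le, by rw [div_le_one h1t]; linarith [hs'.2]⟩, h2, ← sub_div, abs_div, abs_of_pos h1t]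
    rw [sub_sub_sub_cancel_right]
    field_simp
  have e3 : ∀ s ∈ Set.Icc 0 t, ∀ s' ∈ Set.Icc t 1, dist (γ s) (γ s') = |s - s'| * D := by
    intro s hs s' hs'
    have k1 := e1 s hs t ⟨h0.le, le_rfl⟩
    have k2 := e2 t ⟨le_rfl, h1'.le⟩ s' hs'
    have k3 := e1 0 ⟨le_rfl, h0.le⟩ s hs
    have k4 := e2 s' hs' 1 ⟨h1'.le, le_rfl⟩
    rw [g0] at k3
    rw [g1] at k4
    rw [abs_of_nonpos (by linarith [hs.2])] at k1
    rw [abs_of_nonpos (by linarith [hs'.1])] at k2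
    rw [abs_of_nonpos (by linarith [hs.1])] at k3
    rw [abs_of_nonpos (by linarith [hs'.2])] at k4
    rw [abs_of_nonpos (by linarith [hs.2, hs'.1])]
    have t1 := dist_triangle (γ s) (γ t) (γ s')
    have t2 := dist_triangle4 x (γ s) (γ s') y
    apply le_antisymm
    · linarith
    · linarith
  refine ⟨γ, ⟨g0, g1, ?_⟩, gt⟩
  intro s hs s' hs'
  rcases le_total s t with a | a <;> rcases le_total s' t with b | b
  · exact e1 s ⟨hs.1, a⟩ s' ⟨hs'.1, b⟩
  · exact e3 s ⟨hs.1, a⟩ s' ⟨b, hs'.2⟩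
  · rw [dist_comm, abs_sub_comm]; exact e3 s' ⟨hs'.1, b⟩ s ⟨a, hs.2⟩
  · exact e2 s ⟨a, hs.2⟩ s' ⟨b, hs'.2⟩

/-- geodesic with clamped parameter -/
noncomputable def sg (h : IsBNPC Y) (x y : Y) (t : ℝ) : Y :=
  (h.2.1 x y).choose (Set.projIcc (0:ℝ) 1 zero_le_one t)

variable (h : IsBNPC Y)

theorem sg_geo (x y : Y) : IsGeodesic (sg h x y) x y := by
  obtain ⟨a, b, c⟩ := (h.2.1 x y).choose_spec
  refine ⟨?_, ?_, ?_⟩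
  · simp [sg, a]
  · simp [sg, b]
  · intro s hs t ht
    simp only [sg]
    rw [Set.projIcc_of_mem _ hs, Set.projIcc_of_mem _ ht]
    exact c s hs t ht

theorem sg_of_le {x y : Y} {t : ℝ} (ht : t ≤ 0) : sg h x y t = x := by
  refine Eq.trans ?_ (sg_geo h x y).1
  simp only [sg]
  rw [Set.projIcc_of_le_left _ ht, Set.projIcc_of_le_left _ le_rfl]

theorem sg_of_ge {x y : Y} {t : ℝ} (ht : 1 ≤ t) : sg h x y t = y := by
  refine Eq.trans ?_ (sg_geo h x y).2.1
  simp only [sg]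
  rw [Set.projIcc_of_right_le _ ht, Set.projIcc_of_right_le _ le_rfl]

theorem sg_proj (x y : Y) (t : ℝ) :
    sg h x y t = sg h x y (Set.projIcc (0:ℝ) 1 zero_le_one t) := by
  simp [sg]

theorem sg_conv (x y x' y' : Y) {t : ℝ} (ht : t ∈ Set.Icc (0:ℝ) 1) :
    dist (sg h x y t) (sg h x' y' t) ≤ (1 - t) * dist x x' + t * dist y y' :=
  conv_le h (sg_geo h x y) (sg_geo h x' y') ht

theorem const_geo (a : Y) : IsGeodesic (fun _ => a) a a := by
  refine ⟨rfl, rfl, ?_⟩; simp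

theorem sg_conv_pt (x y a : Y) {t : ℝ} (ht : t ∈ Set.Icc (0:ℝ) 1) :
    dist (sg h x y t) a ≤ (1 - t) * dist x a + t * dist y a :=
  conv_le h (sg_geo h x y) (const_geo a) ht

theorem sg_ball {x y a : Y} {ρ : ℝ} (hx : dist x a ≤ ρ) (hy : dist y a ≤ ρ) (t : ℝ) :
    dist (sg h x y t) a ≤ ρ := by
  rw [sg_proj]
  obtain ⟨t, ht⟩ := Set.projIcc (0:ℝ) 1 zero_le_one t
  have := sg_conv_pt h x y a ht
  simp only
  nlinarith [ht.1, ht.2]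

theorem sg_dist_left (x y : Y) {t : ℝ} (ht : t ∈ Set.Icc (0:ℝ) 1) :
    dist x (sg h x y t) = t * dist x y := by
  have := (sg_geo h x y).2.2 0 (by simp) t ht
  rwa [(sg_geo h x y).1, zero_sub, abs_neg, abs_of_nonneg ht.1] at this

theorem sg_dist_right (x y : Y) {t : ℝ} (ht : t ∈ Set.Icc (0:ℝ) 1) :
    dist (sg h x y t) y = (1 - t) * dist x y := by
  have := (sg_geo h x y).2.2 t ht 1 (by simp)
  rwa [(sg_geo h x y).2.1, abs_sub_comm, abs_of_nonneg (by linarith [ht.2])] at this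

theorem sg_unique {x z y : Y} {t : ℝ} (ht : t ∈ Set.Icc (0:ℝ) 1)
    (h1 : dist x z = t * dist x y) (h2 : dist z y = (1 - t) * dist x y) : z = sg h x y t := by
  obtain ⟨γ, hγ, e⟩ := concat h.2.1 x z y t ht h1 h2
  have := conv_le h hγ (sg_geo h x y) ht
  rw [e] at this
  simp only [dist_self, mul_zero, add_zero] at this
  exact dist_le_zero.1 this

theorem sg_sg (p q : Y) {s t : ℝ} (hs : s ∈ Set.Icc (0:ℝ) 1) (ht : t ∈ Set.Icc (0:ℝ) 1) :
    sg h p (sg h p q t) s = sg h p q (s * t) := by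
  have hst : s * t ∈ Set.Icc (0:ℝ) 1 := ⟨mul_nonneg hs.1 ht.1, mul_le_one₀ hs.2 ht.1 ht.2⟩
  symm
  apply sg_unique h hs
  · rw [sg_dist_left h _ _ hst, sg_dist_left h _ _ ht]; ring
  · rw [(sg_geo h p q).2.2 _ hst _ ht, sg_dist_left h _ _ ht, abs_of_nonpos]
    · ring
    · nlinarith [hs.2, ht.1]

theorem sg_mono (p u v : Y) {s t : ℝ} (hs : s ∈ Set.Icc (0:ℝ) 1) (ht : t ∈ Set.Icc (0:ℝ) 1) :
    dist (sg h p u (s * t)) (sg h p v (s * t)) ≤ s * dist (sg h p u t) (sg h p v t) := by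
  rw [← sg_sg h p u hs ht, ← sg_sg h p v hs ht]
  have := sg_conv h p (sg h p u t) p (sg h p v t) hs
  simpa using this

theorem sg_cont : Continuous (fun z : Y × Y × ℝ => sg h z.1 z.2.1 z.2.2) := by
  have key : Continuous (fun z : Y × Y × Set.Icc (0:ℝ) 1 => sg h z.1 z.2.1 z.2.2) := by
    rw [continuous_iff_continuousAt]
    rintro ⟨x, y, t⟩
    rw [ContinuousAt, tendsto_iff_dist_tendsto_zero]
    have b : ∀ z : Y × Y × Set.Icc (0:ℝ) 1, dist (sg h z.1 z.2.1 z.2.2) (sg h x y t) ≤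
        dist z.1 x + dist z.2.1 y + |(z.2.2 : ℝ) - t| * dist x y := by
      rintro ⟨x', y', t'⟩
      have e1 := sg_conv h x' y' x y t'.2
      have e2 := (sg_geo h x y).2.2 t' t'.2 t t.2
      have e3 := dist_triangle (sg h x' y' t') (sg h x y t') (sg h x y t)
      have := t'.2.1
      have := t'.2.2
      simp only
      nlinarith [dist_nonneg (x := x') (y := x), dist_nonneg (x := y') (y := y)]
    refine squeeze_zero (fun _ => dist_nonneg) b ?_
    have : Continuous (fun z : Y × Y × Set.Icc (0:ℝ) 1 =>
        dist z.1 x + dist z.2.1 y + |(z.2.2 : ℝ) - t| * dist x y) := by fun_prop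
    simpa using this.tendsto (x, y, t)
  have := key.comp (f := fun z : Y × Y × ℝ => (z.1, z.2.1, Set.projIcc (0:ℝ) 1 zero_le_one z.2.2))
    (by fun_prop)
  refine this.congr fun z => ?_
  simp only [Function.comp]
  rw [← sg_proj]

/-- deformation lemma -/
theorem deform {A B : Set Y} (hAB : A ⊆ B) (H : Y × ℝ → Y)
    (hc : ContinuousOn H (B ×ˢ Set.Icc (0:ℝ) 1)) (H0 : ∀ x ∈ B, H (x, 0) = x)
    (hB : ∀ x ∈ B, ∀ t ∈ Set.Icc (0:ℝ) 1, H (x, t) ∈ B)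
    (hA : ∀ x ∈ A, ∀ t ∈ Set.Icc (0:ℝ) 1, H (x, t) ∈ A)
    (h1 : ∀ x ∈ B, H (x, 1) ∈ A) : Nonempty (ContinuousMap.HomotopyEquiv A B) := by
  have cB : Continuous (fun z : unitInterval × B => H (z.2, z.1)) :=
    hc.comp_continuous (by fun_prop) (fun z => ⟨z.2.2, z.1.2⟩)
  have cA : Continuous (fun z : unitInterval × A => H (z.2, z.1)) :=
    hc.comp_continuous (by fun_prop) (fun z => ⟨hAB z.2.2, z.1.2⟩)
  let i : C(A, B) := ⟨Set.inclusion hAB, by fun_prop⟩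
  let g : C(B, A) := ⟨fun x => ⟨H (x, 1), h1 x x.2⟩, by
    refine Continuous.subtype_mk ?_ _
    exact cB.comp (f := fun x : B => ((1 : unitInterval), x)) (by fun_prop)⟩
  let KA : ContinuousMap.Homotopy (ContinuousMap.id A) (g.comp i) :=
    { toFun := fun z => ⟨H (z.2, z.1), hA _ z.2.2 _ z.1.2⟩
      continuous_toFun := cA.subtype_mk _
      map_zero_left := fun x => Subtype.ext (by simpa using H0 x (hAB x.2))
      map_one_left := fun x => Subtype.ext (by simp [g, i]) }
  let KB : ContinuousMap.Homotopy (ContinuousMap.id B) (i.comp g) :=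
    { toFun := fun z => ⟨H (z.2, z.1), hB _ z.2.2 _ z.1.2⟩
      continuous_toFun := cB.subtype_mk _
      map_zero_left := fun x => Subtype.ext (by simpa using H0 x x.2)
      map_one_left := fun x => Subtype.ext (by simp [g, i]) }
  exact ⟨⟨i, g, ⟨KA.symm⟩, ⟨KB.symm⟩⟩⟩

end GN

namespace GN

variable {Y : Type*} [MetricSpace Y] (h : IsBNPC Y)

/-- rescaled distance -/
noncomputable def F (p : Y) (t : ℝ) (z : Y × Y) : ℝ :=
  dist (sg h p z.1 t) (sg h p z.2 t) / t

theorem F_mono (p : Y) (z : Y × Y) {s t : ℝ} (hs : 0 < s) (hst : s ≤ t) (ht : t ≤ 1) :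
    F h p s z ≤ F h p t z := by
  have ht0 : 0 < t := hs.trans_le hst
  have := sg_mono h p z.1 z.2 (s := s / t) (t := t)
    ⟨by positivity, by rw [div_le_one ht0]; exact hst⟩ ⟨ht0.le, ht⟩
  rw [div_mul_cancel₀ _ ht0.ne'] at this
  simp only [F]
  rw [div_le_iff₀ hs]
  calc _ ≤ _ := this
    _ = _ := by ring

theorem F_lip (p : Y) (z w : Y × Y) {t : ℝ} (ht : 0 < t) (ht1 : t ≤ 1) :
    F h p t z ≤ F h p t w + (dist z.1 w.1 + dist z.2 w.2) := by
  have e1 := sg_conv h p z.1 p w.1 ⟨ht.le, ht1⟩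
  have e2 := sg_conv h p z.2 p w.2 ⟨ht.le, ht1⟩
  have e3 := dist_triangle4 (sg h p z.1 t) (sg h p w.1 t) (sg h p w.2 t) (sg h p z.2 t)
  rw [dist_comm (sg h p w.2 t)] at e3
  simp only [F, dist_self, mul_zero, zero_add] at *
  rw [div_add' _ _ _ ht.ne']
  gcongr
  nlinarith

theorem unif (p : Y) {K : Set (Y × Y)} (hK : IsCompact K) {ε : ℝ} (hε : 0 < ε) :
    ∃ l : ℝ, 0 < l ∧ l ≤ 1 ∧ ∀ z ∈ K, ∀ t, 0 < t → t ≤ l → F h p l z ≤ F h p t z + ε := by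
  refine hK.induction_on (p := fun K => ∃ l : ℝ, 0 < l ∧ l ≤ 1 ∧ ∀ z ∈ K, ∀ t, 0 < t → t ≤ l →
    F h p l z ≤ F h p t z + ε) ?_ ?_ ?_ ?_
  · exact ⟨1, by simp⟩
  · rintro s t hst ⟨l, h0, h1, hl⟩
    exact ⟨l, h0, h1, fun z hz => hl z (hst hz)⟩
  · rintro s t ⟨l, h0, h1, hl⟩ ⟨m, i0, i1, hm⟩
    refine ⟨min l m, lt_min h0 i0, (min_le_left _ _).trans h1, ?_⟩
    rintro z (hz | hz) t ht htl
    · exact (F_mono h p z (lt_min h0 i0) (min_le_left _ _) h1).trans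
        (hl z hz t ht (htl.trans (min_le_left _ _)))
    · exact (F_mono h p z (lt_min h0 i0) (min_le_right _ _) i1).trans
        (hm z hz t ht (htl.trans (min_le_right _ _)))
  · intro z _
    have hne : ((fun t => F h p t z) '' Set.Ioc 0 1).Nonempty := ⟨_, 1, by simp, rfl⟩
    have hbd : BddBelow ((fun t => F h p t z) '' Set.Ioc 0 1) := by
      refine ⟨0, ?_⟩
      rintro _ ⟨t, ht, rfl⟩
      exact div_nonneg dist_nonneg ht.1.le
    obtain ⟨_, ⟨l, hl, rfl⟩, hlt⟩ := exists_lt_of_csInf_lt hne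
      (show sInf ((fun t => F h p t z) '' Set.Ioc 0 1) < sInf ((fun t => F h p t z) '' Set.Ioc 0 1) + ε / 5 by linarith)
    refine ⟨Metric.ball z (ε / 5), mem_nhdsWithin_of_mem_nhds (Metric.ball_mem_nhds _ (by positivity)),
      l, hl.1, hl.2, ?_⟩
    intro w hw t ht htl
    have hw : dist w z < ε / 5 := hw
    rw [Prod.dist_eq, max_lt_iff] at hw
    have e1 := F_lip h p w z hl.1 hl.2
    have e2 := F_lip h p z w ht (htl.trans hl.2)
    have e3 := csInf_le hbd ⟨t, ⟨ht, htl.trans hl.2⟩, rfl⟩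
    rw [dist_comm z.1, dist_comm z.2] at e2
    simp only at hlt e3
    linarith [hw.1, hw.2]

/-- push outwards -/
noncomputable def push (R : ℝ) (p x : Y) : List Y → Y → Y
  | [], y => y
  | q :: l, y => push R p x l
      (sg h y q (2 - 8 * (dist x (sg h p q (dist p x / R)) / dist p x)))

theorem push_cont (R : ℝ) (p : Y) (l : List Y) {E : Set Y} (hE : ∀ x ∈ E, dist p x ≠ 0) :
    ∀ f : Y → Y, ContinuousOn f E → ContinuousOn (fun x => push h R p x l (f x)) E := by
  induction l with
  | nil => intro f hf; exact hf
  | cons q l ih =>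
    intro f hf
    apply ih (fun x => sg h (f x) q (2 - 8 * (dist x (sg h p q (dist p x / R)) / dist p x)))
    have a : Continuous (fun x => sg h p q (dist p x / R)) :=
      (sg_cont h).comp (f := fun x : Y => (p, q, dist p x / R)) (by fun_prop)
    have b : ContinuousOn (fun x => 2 - 8 * (dist x (sg h p q (dist p x / R)) / dist p x)) E := by
      refine continuousOn_const.sub (continuousOn_const.mul (ContinuousOn.div ?_ ?_ hE))
      · exact (continuous_id.dist a).continuousOn
      · fun_prop
    exact (sg_cont h).comp_continuousOn (hf.prodMk (continuousOn_const.prodMk b))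

theorem push_ball (R : ℝ) (p x a : Y) {ρ : ℝ} (l : List Y)
    (hl : ∀ q ∈ l, dist x (sg h p q (dist p x / R)) / dist p x < 1 / 4 → dist q a ≤ ρ) :
    ∀ y, dist y a ≤ ρ → dist (push h R p x l y) a ≤ ρ := by
  induction l with
  | nil => intro y hy; exact hy
  | cons q l ih =>
    intro y hy
    refine ih (fun q hq => hl q (List.mem_cons_of_mem _ hq)) _ ?_
    by_cases hq : dist x (sg h p q (dist p x / R)) / dist p x < 1 / 4
    · exact sg_ball h hy (hl q List.mem_cons_self hq) _
    · rw [sg_of_le h (by linarith)]; exact hy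

theorem push_ball' (R : ℝ) (p x a : Y) {ρ : ℝ} (l : List Y)
    (hl : ∀ q ∈ l, dist x (sg h p q (dist p x / R)) / dist p x < 1 / 4 → dist q a ≤ ρ)
    (hl' : ∃ q ∈ l, dist x (sg h p q (dist p x / R)) / dist p x ≤ 1 / 8) :
    ∀ y, dist (push h R p x l y) a ≤ ρ := by
  induction l with
  | nil => simp at hl'
  | cons q l ih =>
    intro y
    obtain ⟨q', hq', hd⟩ := hl'
    rcases List.mem_cons.1 hq' with rfl | hq'
    · refine push_ball h R p x a l (fun q hq => hl q (List.mem_cons_of_mem _ hq)) _ ?_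
      rw [sg_of_ge h (by linarith)]
      exact hl _ List.mem_cons_self (by linarith)
    · exact ih (fun q hq => hl q (List.mem_cons_of_mem _ hq)) ⟨q', hq', hd⟩ _

theorem core (h : IsBNPC Y) (p : Y) {R0 : ℝ} (hR0 : 0 < R0) (hc : IsCompact (Metric.closedBall p R0))
    (ext : ∀ x, 0 < dist p x → dist p x ≤ R0 → ∃ u, dist p u = R0 ∧ dist p x + dist x u = R0) :
    ∃ r₀ : ℝ, 0 < r₀ ∧ r₀ ≤ R0 ∧ ∀ r s : ℝ, 0 < r → r < r₀ → 0 < s → s < r₀ →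
      Nonempty (ContinuousMap.HomotopyEquiv
        {x : Y | dist p x = r} {x : Y | 0 < dist p x ∧ dist p x < s}) := by
  have cd : Continuous (fun x : Y => dist p x) := by fun_prop
  have cS : ∀ R ≤ R0, IsCompact {x : Y | dist p x = R} := by
    intro R hR
    refine hc.of_isClosed_subset (isClosed_eq cd continuous_const) ?_
    intro x hx
    rw [Metric.mem_closedBall, dist_comm]
    exact (show dist p x = R from hx).le.trans hR
  obtain ⟨l, l0, l1, hl⟩ := unif h p ((cS R0 le_rfl).prod (cS R0 le_rfl)) (ε := R0 / 8) (by positivity)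
  set R := l * R0 with hR
  have Rpos : 0 < R := by positivity
  have RR0 : R ≤ R0 := by nlinarith
  -- extension to radius `R`
  have ext2 : ∀ x, 0 < dist p x → dist p x ≤ R → ∃ u, dist p u = R0 ∧
      x = sg h p u (dist p x / R * l) := by
    intro x hx0 hxR
    obtain ⟨u, hu, hxu⟩ := ext x hx0 (hxR.trans RR0)
    have e : dist p x / R * l = dist p x / R0 := by rw [hR]; field_simp
    refine ⟨u, hu, ?_⟩
    rw [e]
    apply sg_unique h ⟨by positivity, by rw [div_le_one hR0]; linarith⟩
    · rw [hu]; field_simp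
    · rw [hu]; field_simp; linarith
  have lI : l ∈ Set.Icc (0:ℝ) 1 := ⟨l0.le, l1⟩
  have ext3 : ∀ x, 0 < dist p x → dist p x ≤ R → ∃ a, dist p a = R ∧
      x = sg h p a (dist p x / R) ∧ ∀ b, dist p b = R →
        dist a b ≤ R * (dist x (sg h p b (dist p x / R)) / dist p x) + R / 8 := by
    intro x hx0 hxR
    obtain ⟨u, hu, hxu⟩ := ext2 x hx0 hxR
    have tI : dist p x / R ∈ Set.Icc (0:ℝ) 1 := ⟨by positivity, by rw [div_le_one Rpos]; exact hxR⟩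
    have hxa : x = sg h p (sg h p u l) (dist p x / R) := by
      rw [sg_sg h p u tI lI]; exact hxu
    refine ⟨sg h p u l, by rw [sg_dist_left h _ _ lI, hu], hxa, ?_⟩
    intro b hb
    obtain ⟨v, hv, hbv⟩ := ext2 b (by linarith) hb.le
    rw [hb, div_self Rpos.ne', one_mul] at hbv
    have tpos : 0 < dist p x / R * l := by positivity
    have key := hl (u, v) ⟨hu, hv⟩ (dist p x / R * l) tpos (by nlinarith [tI.2])
    have e1 : sg h p b (dist p x / R) = sg h p v (dist p x / R * l) := by
      rw [hbv, sg_sg h p v tI lI]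
    rw [e1]
    simp only [F] at key
    rw [← hbv, ← hxu, div_le_iff₀ l0] at key
    refine key.trans (le_of_eq ?_)
    rw [hR]
    field_simp
  -- net
  obtain ⟨N, hNs, hNf, hN⟩ := Metric.finite_approx_of_totallyBounded
    ((cS R RR0).totallyBounded) (R / 8) (by positivity)
  set L := hNf.toFinset.toList with hL
  have memL : ∀ q, q ∈ L ↔ q ∈ N := by intro q; simp [hL]
  set φ : Y → Y := fun x => push h R p x L x with hφ
  have φball : ∀ x, 0 < dist p x → dist p x ≤ R → dist p (φ x) ≤ R := by
    intro x _ hx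
    rw [dist_comm]
    refine push_ball h R p x p L ?_ x (by rwa [dist_comm])
    intro q hq _
    rw [dist_comm]
    exact (show dist p q = R from hNs ((memL q).1 hq)).le
  have φext : ∀ x, 0 < dist p x → dist p x ≤ R → ∃ a, dist p a = R ∧
      x = sg h p a (dist p x / R) ∧ dist (φ x) a ≤ 3 * R / 8 := by
    intro x hx0 hxR
    obtain ⟨a, ha, hxa, hab⟩ := ext3 x hx0 hxR
    have tI : dist p x / R ∈ Set.Icc (0:ℝ) 1 := ⟨by positivity, by rw [div_le_one Rpos]; exact hxR⟩
    refine ⟨a, ha, hxa, ?_⟩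
    apply push_ball' h R p x a L
    · intro q hq hlt
      have := hab q (hNs ((memL q).1 hq))
      rw [dist_comm]
      nlinarith
    · have hm := hN (show a ∈ {x : Y | dist p x = R} from ha)
      simp only [Set.mem_iUnion, Metric.mem_ball, exists_prop] at hm
      obtain ⟨q, hq, hd⟩ := hm
      refine ⟨q, (memL q).2 hq, ?_⟩
      have := sg_conv h p a p q tI
      rw [← hxa, dist_self, mul_zero, zero_add] at this
      rw [div_le_iff₀ hx0]
      calc _ ≤ _ := this
        _ ≤ dist p x / R * (R / 8) := by gcongr
        _ = _ := by field_simp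
  refine ⟨R / 2, by positivity, by linarith, ?_⟩
  intro r s hr hrR hs hsR
  have sgd : ∀ x (t : ℝ), t ∈ Set.Icc (0:ℝ) 1 → dist p (sg h p x t) = t * dist p x :=
    fun x t ht => sg_dist_left h p x ht
  have E1 : Nonempty (ContinuousMap.HomotopyEquiv {x : Y | dist p x = r}
      {x : Y | r ≤ dist p x ∧ dist p x ≤ R}) := by
    have hI : ∀ x : Y, r ≤ dist p x → ∀ t ∈ Set.Icc (0:ℝ) 1,
        1 - t + t * (r / dist p x) ∈ Set.Icc (0:ℝ) 1 := by
      intro x hx t ht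
      have a : r / dist p x ≤ 1 := by rw [div_le_one (by linarith)]; exact hx
      have b : 0 ≤ r / dist p x := by positivity
      constructor <;> nlinarith [ht.1, ht.2]
    have hd : ∀ x : Y, r ≤ dist p x → ∀ t ∈ Set.Icc (0:ℝ) 1,
        dist p (sg h p x (1 - t + t * (r / dist p x))) = (1 - t) * dist p x + t * r := by
      intro x hx t ht
      rw [sgd _ _ (hI x hx t ht)]
      have : dist p x ≠ 0 := by linarith
      field_simp
    refine deform ?_ (fun z => sg h p z.1 (1 - z.2 + z.2 * (r / dist p z.1))) ?_ ?_ ?_ ?_ ?_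
    · intro x hx
      have hx : dist p x = r := hx
      exact ⟨hx.ge, by linarith⟩
    · suffices hs : ContinuousOn (fun z : Y × ℝ => 1 - z.2 + z.2 * (r / dist p z.1))
          ({x : Y | r ≤ dist p x ∧ dist p x ≤ R} ×ˢ Set.Icc (0:ℝ) 1) from
        (sg_cont h).comp_continuousOn (continuousOn_const.prodMk (continuousOn_fst.prodMk hs))
      refine ContinuousOn.add (by fun_prop) (ContinuousOn.mul (by fun_prop)
        (ContinuousOn.div continuousOn_const (by fun_prop) ?_))
      rintro ⟨x, t⟩ ⟨hx, _⟩
      have := hx.1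
      simp only at this ⊢
      linarith
    · intro x _
      exact sg_of_ge h (by simp)
    · intro x hx t ht
      simp only [Set.mem_ofPred_eq]
      rw [hd x hx.1 t ht]
      have := hx.1
      have := hx.2
      constructor <;> nlinarith [ht.1, ht.2]
    · intro x hx t ht
      have hx : dist p x = r := hx
      simp only [Set.mem_ofPred_eq]
      rw [hd x hx.ge t ht, hx]; ring
    · intro x hx
      simp only [Set.mem_ofPred_eq]
      rw [hd x hx.1 1 (by simp)]; ring
  have E2 : Nonempty (ContinuousMap.HomotopyEquiv {x : Y | r ≤ dist p x ∧ dist p x ≤ R}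
      {x : Y | 0 < dist p x ∧ dist p x ≤ R}) := by
    have hlow : ∀ x, 0 < dist p x → dist p x ≤ R → ∀ t ∈ Set.Icc (0:ℝ) 1,
        (1 - t) * dist p x + t * (5 * R / 8) ≤ dist p (sg h x (φ x) t) := by
      intro x hx0 hxR t ht
      obtain ⟨a, ha, hxa, hd⟩ := φext x hx0 hxR
      have tI : dist p x / R ∈ Set.Icc (0:ℝ) 1 := ⟨by positivity, by rw [div_le_one Rpos]; exact hxR⟩
      have e1 := sg_conv h x (φ x) x a ht
      have e2 : dist (sg h x a t) a = (1 - t) * dist x a := sg_dist_right h x a ht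
      have e3 : dist x a = R - dist p x := by
        have := sg_dist_right h p a tI
        rw [← hxa, ha] at this
        rw [this]; field_simp
      have e4 := dist_triangle4 p (sg h x (φ x) t) (sg h x a t) a
      rw [dist_self, mul_zero, zero_add] at e1
      rw [e3] at e2
      nlinarith [ht.1, ht.2]
    have hup : ∀ x, 0 < dist p x → dist p x ≤ R → ∀ t : ℝ, dist p (sg h x (φ x) t) ≤ R := by
      intro x hx0 hxR t
      rw [dist_comm]
      exact sg_ball h (by rwa [dist_comm]) (by rw [dist_comm]; exact φball x hx0 hxR) t
    refine deform ?_ (fun z => sg h z.1 (φ z.1) z.2) ?_ ?_ ?_ ?_ ?_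
    · intro x hx
      exact ⟨hr.trans_le hx.1, hx.2⟩
    · have : ContinuousOn φ {x : Y | 0 < dist p x ∧ dist p x ≤ R} :=
        push_cont h R p L (fun x hx => hx.1.ne') id continuousOn_id
      refine (sg_cont h).comp_continuousOn (continuousOn_fst.prodMk
        (ContinuousOn.prodMk ?_ continuousOn_snd))
      exact this.comp continuousOn_fst (fun z hz => hz.1)
    · intro x _
      exact sg_of_le h le_rfl
    · intro x hx t ht
      refine ⟨lt_of_lt_of_le ?_ (hlow x hx.1 hx.2 t ht), hup x hx.1 hx.2 t⟩
      have := hx.1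
      rcases eq_or_lt_of_le ht.1 with h0 | h0
      · rw [← h0]; linarith
      · have := ht.2
        have : 0 ≤ (1 - t) * dist p x := mul_nonneg (by linarith) dist_nonneg
        have : 0 < t * (5 * R / 8) := by positivity
        linarith
    · intro x hx t ht
      have hx0 := hr.trans_le hx.1
      refine ⟨le_trans ?_ (hlow x hx0 hx.2 t ht), hup x hx0 hx.2 t⟩
      have := hx.1
      nlinarith [ht.1, ht.2]
    · intro x hx
      refine ⟨le_trans ?_ (hlow x hx.1 hx.2 1 (by simp)), hup x hx.1 hx.2 1⟩
      linarith
  have E3 : Nonempty (ContinuousMap.HomotopyEquiv {x : Y | 0 < dist p x ∧ dist p x < s}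
      {x : Y | 0 < dist p x ∧ dist p x ≤ R}) := by
    have c0 : 0 < s / (2 * R) := by positivity
    have c1 : s / (2 * R) < 1 := by rw [div_lt_one (by positivity)]; linarith
    have hI : ∀ t ∈ Set.Icc (0:ℝ) 1, 0 < 1 - t + t * (s / (2 * R)) ∧
        1 - t + t * (s / (2 * R)) ≤ 1 := by
      intro t ht
      constructor
      · rcases eq_or_lt_of_le ht.1 with h0 | h0
        · rw [← h0]; norm_num
        · have := mul_pos h0 c0
          linarith [ht.2]
      · nlinarith [ht.1, ht.2]
    have hd : ∀ x : Y, ∀ t ∈ Set.Icc (0:ℝ) 1, dist p (sg h p x (1 - t + t * (s / (2 * R)))) =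
        (1 - t + t * (s / (2 * R))) * dist p x :=
      fun x t ht => sgd _ _ ⟨(hI t ht).1.le, (hI t ht).2⟩
    have hle : ∀ x : Y, ∀ t ∈ Set.Icc (0:ℝ) 1, dist p (sg h p x (1 - t + t * (s / (2 * R)))) ≤
        dist p x := by
      intro x t ht
      rw [hd x t ht]
      exact mul_le_of_le_one_left dist_nonneg (hI t ht).2
    have hpos : ∀ x : Y, 0 < dist p x → ∀ t ∈ Set.Icc (0:ℝ) 1,
        0 < dist p (sg h p x (1 - t + t * (s / (2 * R)))) := by
      intro x hx t ht
      rw [hd x t ht]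
      exact mul_pos (hI t ht).1 hx
    refine deform ?_ (fun z => sg h p z.1 (1 - z.2 + z.2 * (s / (2 * R)))) ?_ ?_ ?_ ?_ ?_
    · intro x hx
      exact ⟨hx.1, by linarith [hx.2]⟩
    · exact ((sg_cont h).comp (f := fun z : Y × ℝ => (p, z.1, 1 - z.2 + z.2 * (s / (2 * R))))
        (by fun_prop)).continuousOn
    · intro x _
      exact sg_of_ge h (by simp)
    · intro x hx t ht
      exact ⟨hpos x hx.1 t ht, (hle x t ht).trans hx.2⟩
    · intro x hx t ht
      exact ⟨hpos x hx.1 t ht, (hle x t ht).trans_lt hx.2⟩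
    · intro x hx
      refine ⟨hpos x hx.1 1 (by simp), ?_⟩
      simp only
      rw [hd x 1 (by simp)]
      calc _ ≤ (1 - 1 + 1 * (s / (2 * R))) * R := by
            refine mul_le_mul_of_nonneg_left hx.2 ?_
            linarith
        _ = s / 2 := by field_simp; ring
        _ < s := by linarith
  obtain ⟨e1⟩ := E1
  obtain ⟨e2⟩ := E2
  obtain ⟨e3⟩ := E3
  exact ⟨(e1.trans e2).trans e3.symm⟩

end GN

namespace GN

variable {X : Type*} [MetricSpace X]

theorem ext_lemma (hX : LocallyGeodesicallyComplete X) (p : X) {R0 R1 : ℝ} (hR : R0 < R1)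
    (hb : IsBNPC (Metric.closedBall p R1)) (hc : IsCompact (Metric.closedBall p R0))
    (x : X) (hx0 : 0 < dist p x) (hxR : dist p x ≤ R0) :
    ∃ u, dist p u = R0 ∧ dist p x + dist x u = R0 := by
  have hT : IsCompact {y : X | y ∈ Metric.closedBall p R0 ∧ dist p y = dist p x + dist x y} :=
    hc.of_isClosed_subset (Metric.isClosed_closedBall.inter
      (isClosed_eq (by fun_prop) (by fun_prop))) (fun y hy => hy.1)
  have hxT : x ∈ {y : X | y ∈ Metric.closedBall p R0 ∧ dist p y = dist p x + dist x y} :=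
    ⟨by rwa [Metric.mem_closedBall, dist_comm], by simp⟩
  obtain ⟨y, hy, hmax⟩ := hT.exists_isMaxOn ⟨x, hxT⟩ (f := fun y => dist p y) (by fun_prop)
  have hyR : dist p y ≤ R0 := by have := hy.1; rwa [Metric.mem_closedBall, dist_comm] at this
  rcases eq_or_lt_of_le hyR with hyR | hyR
  · exact ⟨y, hyR, hy.2 ▸ hyR⟩
  exfalso
  have L0 : 0 < dist p y := hx0.trans_le (hmax hxT)
  set L := dist p y with hL
  let p' : Metric.closedBall p R1 := ⟨p, by simp; linarith⟩
  have inB : ∀ z, dist p z ≤ R1 → z ∈ Metric.closedBall p R1 := fun z hz => by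
    rwa [Metric.mem_closedBall, dist_comm]
  let y' : Metric.closedBall p R1 := ⟨y, inB y (by linarith)⟩
  obtain ⟨g, hg⟩ := hb.2.1 p' y'
  have hpy : dist p' y' = L := rfl
  have hsp : IsShortestPathOn (fun τ => (g (τ / L) : X)) 0 L := by
    intro s hs t ht
    have := hg.2.2 (s / L) ⟨div_nonneg hs.1 L0.le, by rw [div_le_one L0]; exact hs.2⟩
      (t / L) ⟨div_nonneg ht.1 L0.le, by rw [div_le_one L0]; exact ht.2⟩
    rw [hpy, ← sub_div, abs_div, abs_of_pos L0, div_mul_cancel₀ _ L0.ne'] at this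
    exact this
  obtain ⟨ε, hε, γ, hγ, hloc⟩ := hX _ 0 L L0.le hsp
  obtain ⟨δ, hδ, hiso⟩ := hloc L ⟨by linarith, by linarith⟩
  obtain ⟨d, d0, dδ, dε, dL, dR⟩ : ∃ d, 0 < d ∧ d ≤ δ ∧ d ≤ ε ∧ d ≤ L ∧ d ≤ R0 - L := by
    refine ⟨min (min δ ε) (min L (R0 - L)), ?_, ?_, ?_, ?_, ?_⟩
    · have : 0 < R0 - L := by linarith
      positivity
    · exact (min_le_left _ _).trans (min_le_left _ _)
    · exact (min_le_left _ _).trans (min_le_right _ _)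
    · exact (min_le_right _ _).trans (min_le_left _ _)
    · exact (min_le_right _ _).trans (min_le_right _ _)
  have m1 : L + d ∈ Set.Icc (0 - ε) (L + ε) ∩ Set.Icc (L - δ) (L + δ) :=
    ⟨⟨by linarith, by linarith⟩, by linarith, by linarith⟩
  have m2 : L ∈ Set.Icc (0 - ε) (L + ε) ∩ Set.Icc (L - δ) (L + δ) :=
    ⟨⟨by linarith, by linarith⟩, by linarith, by linarith⟩
  have m3 : L - d ∈ Set.Icc (0 - ε) (L + ε) ∩ Set.Icc (L - δ) (L + δ) :=
    ⟨⟨by linarith, by linarith⟩, by linarith, by linarith⟩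
  have i1 := hiso L m2 (L + d) m1
  have i2 := hiso (L - d) m3 (L + d) m1
  have gL : γ L = y := by
    rw [hγ L ⟨L0.le, le_rfl⟩, div_self L0.ne', hg.2.1]
  have gLd : γ (L - d) = g (1 - d / L) := by
    rw [hγ (L - d) ⟨by linarith, by linarith⟩, sub_div, div_self L0.ne']
  rw [gL, abs_of_nonpos (by linarith)] at i1
  rw [abs_of_nonpos (by linarith), gLd] at i2
  set y1 := γ (L + d) with hy1
  have up : dist p y1 ≤ L + d := by
    have := dist_triangle p y y1
    linarith
  let z : Metric.closedBall p R1 := ⟨y1, inB y1 (by linarith)⟩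
  have cv := conv_le hb hg (const_geo z) (t := 1 - d / L)
    ⟨by rw [sub_nonneg, div_le_one L0]; exact dL, by linarith [div_pos d0 L0]⟩
  have c1 : dist (g (1 - d / L)) z = 2 * d := by
    have : dist (g (1 - d / L)) z = dist (g (1 - d / L) : X) y1 := rfl
    rw [this, i2]; ring
  have c2 : dist p' z = dist p y1 := rfl
  have c3 : dist y' z = d := by
    have : dist y' z = dist y y1 := rfl
    rw [this, i1]; ring
  rw [c1, c2, c3] at cv
  have lo : L + d ≤ dist p y1 := by
    have e : (1 - (1 - d / L)) * dist p y1 + (1 - d / L) * d = d * (dist p y1 + L - d) / L := by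
      field_simp; ring
    rw [e, le_div_iff₀ L0] at cv
    have : 2 * L ≤ dist p y1 + L - d := by
      by_contra hcon
      push Not at hcon
      nlinarith
    linarith
  have hy2 := hy.2
  have t1 := dist_triangle x y y1
  have t2 := dist_triangle p x y1
  have hfin : y1 ∈ {y : X | y ∈ Metric.closedBall p R0 ∧ dist p y = dist p x + dist x y} := by
    refine ⟨by rw [Metric.mem_closedBall, dist_comm]; linarith, ?_⟩
    linarith
  have : dist p y1 ≤ L := hmax hfin
  linarith

/-- transfer -/
noncomputable def homeo (p : X) {R1 : ℝ} (P : ℝ → Prop) (hP : ∀ a, P a → a ≤ R1) (p' : Metric.closedBall p R1)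
    (hp' : (p' : X) = p) :
    {y : Metric.closedBall p R1 | P (dist p' y)} ≃ₜ {x : X | P (dist p x)} where
  toFun y := ⟨y.1.1, by have := y.2; simp only [Set.mem_ofPred_eq, Subtype.dist_eq, hp'] at this ⊢; exact this⟩
  invFun x := ⟨⟨x.1, by rw [Metric.mem_closedBall, dist_comm]; exact hP _ x.2⟩, by
    have := x.2; simp only [Set.mem_ofPred_eq, Subtype.dist_eq, hp'] at this ⊢; exact this⟩
  left_inv y := rfl
  right_inv x := rfl
  continuous_toFun := by fun_prop
  continuous_invFun := by fun_prop

end GN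

/-- In a GNPC space, all sufficiently small metric spheres around a point have
the same homotopy type, which is also that of small punctured balls. -/
theorem gnpc_small_spheres_homotopy_equivalent
    (X : Type*) [MetricSpace X] (hX : IsGNPC X) (p : X) :
    ∃ r₀ : ℝ, 0 < r₀ ∧ ∀ r s : ℝ, 0 < r → r < r₀ → 0 < s → s < r₀ →
      Nonempty (ContinuousMap.HomotopyEquiv
        {x : X | dist p x = r} {x : X | dist p x = s}) ∧
      Nonempty (ContinuousMap.HomotopyEquiv
        {x : X | dist p x = r} {x : X | 0 < dist p x ∧ dist p x < s}) := by
  obtain ⟨-, hlc, hgc, hbn⟩ := hX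
  obtain ⟨R1, R1pos, hb⟩ := hbn p
  obtain ⟨K, hK, hKp⟩ := exists_compact_mem_nhds p
  obtain ⟨e, e0, he⟩ := Metric.nhds_basis_closedBall.mem_iff.1 hKp
  have hmin : 0 < min e (R1 / 2) := by positivity
  set R0 := min e (R1 / 2) with hR0
  have hR01 : R0 < R1 := (min_le_right _ _).trans_lt (by linarith)
  have hc : IsCompact (Metric.closedBall p R0) :=
    hK.of_isClosed_subset Metric.isClosed_closedBall
      ((Metric.closedBall_subset_closedBall (min_le_left _ _)).trans he)
  let p' : Metric.closedBall p R1 := ⟨p, by simp; linarith⟩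
  have hc' : IsCompact (Metric.closedBall p' R0) := by
    rw [Subtype.isCompact_iff]
    convert hc using 1
    ext x
    constructor
    · rintro ⟨y, hy, rfl⟩
      exact hy
    · intro hx
      exact ⟨⟨x, Metric.closedBall_subset_closedBall hR01.le hx⟩, hx, rfl⟩
  have hext : ∀ x : Metric.closedBall p R1, 0 < dist p' x → dist p' x ≤ R0 →
      ∃ u, dist p' u = R0 ∧ dist p' x + dist x u = R0 := by
    intro x h0 h1
    obtain ⟨u, hu, hxu⟩ := GN.ext_lemma hgc p hR01 hb hc x.1 h0 h1
    exact ⟨⟨u, by rw [Metric.mem_closedBall, dist_comm]; linarith⟩, hu, hxu⟩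
  obtain ⟨r₀, r0, r0R, hr⟩ := GN.core hb p' hmin hc' hext
  have main : ∀ r s : ℝ, 0 < r → r < r₀ → 0 < s → s < r₀ → Nonempty (ContinuousMap.HomotopyEquiv
        {x : X | dist p x = r} {x : X | 0 < dist p x ∧ dist p x < s}) := by
    intro r s a b c d
    obtain ⟨e⟩ := hr r s a b c d
    have e1 := (GN.homeo p (fun a => a = r) (fun a ha => by linarith) p' rfl).toHomotopyEquiv
    have e2 := (GN.homeo p (fun a => 0 < a ∧ a < s) (fun a ha => by linarith [ha.2]) p' rfl).toHomotopyEquiv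
    exact ⟨(e1.symm.trans e).trans e2⟩
  refine ⟨r₀, r0, fun r s a b c d => ⟨?_, main r s a b c d⟩⟩
  obtain ⟨e1⟩ := main r s a b c d
  obtain ⟨e2⟩ := main s s c d c d
  exact ⟨e1.trans e2.symm⟩
end

section
/- Let X be a metric space and p ∈ X such that the closed ball of radius 10 around p, with the induced metric, is a compact BNPC space, and such that every shortest path γ : [0, ℓ] → X with γ 0 ∈ B(p,1), image contained in the closed ball of radius 10 around p, and ℓ < 2, extends to a shortest path γ̄ : [0, 2] → X with image in that closed ball and γ̄ t = γ t for t ∈ [0, ℓ]. If L : ℕ is such that every subset of the closed ball of radius 10 around p whose points have pairwise distances ≥ 1 has cardinality at most L, then for every q ∈ B(p,1) and every t with 0 < t < 2, every subset of B(q, t) whose points have pairwise distances ≥ t/2 has cardinality at most L. -/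
open Set Metric

/-- Doubling property of tiny balls: a packing bound at scale 1 in the large
closed ball yields a packing bound at all scales in small balls. -/
theorem tiny_ball_doubling
    (X : Type*) [MetricSpace X] (p : X)
    (hCpt : CompactSpace (Metric.closedBall p 10))
    (hBNPC : IsBNPC (Metric.closedBall p 10))
    (hExt : ∀ (γ : ℝ → X) (ℓ : ℝ), 0 ≤ ℓ → ℓ < 2 → IsShortestPathOn γ 0 ℓ →
      γ 0 ∈ Metric.ball p 1 →
      (∀ t ∈ Set.Icc 0 ℓ, γ t ∈ Metric.closedBall p 10) →
      ∃ γ' : ℝ → X, IsShortestPathOn γ' 0 2 ∧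
        (∀ t ∈ Set.Icc (0:ℝ) 2, γ' t ∈ Metric.closedBall p 10) ∧
        ∀ t ∈ Set.Icc 0 ℓ, γ' t = γ t)
    (L : ℕ)
    (hL : ∀ S : Finset X, (↑S ⊆ Metric.closedBall p 10) →
      (∀ x ∈ S, ∀ y ∈ S, x ≠ y → 1 ≤ dist x y) → S.card ≤ L) :
    ∀ q ∈ Metric.ball p 1, ∀ t : ℝ, 0 < t → t < 2 →
      ∀ S : Finset X, (↑S ⊆ Metric.ball q t) →
        (∀ x ∈ S, ∀ y ∈ S, x ≠ y → t / 2 ≤ dist x y) → S.card ≤ L := by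
  intro q hq t ht0 ht2 S hSq hSsep
  rw [Metric.mem_ball] at hq
  have hqB : q ∈ Metric.closedBall p 10 := by
    rw [Metric.mem_closedBall]; linarith
  obtain ⟨-, hgeo, hconv⟩ := hBNPC
  have key : ∀ x ∈ S, ∃ (η : ℝ → Metric.closedBall p 10),
      IsGeodesic η ⟨q, hqB⟩ (η 1) ∧ ((η (t/2) : Metric.closedBall p 10) : X) = x := by
    intro x hx
    have hxq : dist x q < t := Metric.mem_ball.1 (hSq hx)
    have hxB : x ∈ Metric.closedBall p 10 := by
      rw [Metric.mem_closedBall]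
      have := dist_triangle x q p
      linarith
    obtain ⟨g, g0, g1, hg⟩ := hgeo ⟨q, hqB⟩ ⟨x, hxB⟩
    set d := dist q x with hd
    have hd0 : 0 ≤ d := dist_nonneg
    have hdt : d < t := by rw [hd, dist_comm]; exact hxq
    have hg' : ∀ s ∈ Set.Icc (0:ℝ) 1, ∀ u ∈ Set.Icc (0:ℝ) 1,
      dist (g s : X) (g u : X) = |s - u| * d := hg
    have hdiv : ∀ s ∈ Set.Icc 0 d, s / d ∈ Set.Icc (0:ℝ) 1 := fun s hs =>
      ⟨div_nonneg hs.1 hd0, div_le_one_of_le₀ hs.2 hd0⟩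
    have hsp : IsShortestPathOn (fun s => ((g (s / d) : Metric.closedBall p 10) : X)) 0 d := by
      intro s hs u hu
      change dist (g (s / d) : X) (g (u / d) : X) = _
      rw [hg' _ (hdiv s hs) _ (hdiv u hu)]
      rcases hd0.eq_or_lt with h | h
      · rw [← h] at hs hu
        have h1 : s = 0 := le_antisymm hs.2 hs.1
        have h2 : u = 0 := le_antisymm hu.2 hu.1
        simp [h1, h2]
      · rw [← sub_div, abs_div, abs_of_pos h, div_mul_cancel₀ _ h.ne']
    obtain ⟨c, hc, hcB, hce⟩ := hExt _ d hd0 (hdt.trans ht2) hsp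
      (by simp only [zero_div, g0]; exact Metric.mem_ball.2 hq) (fun s _ => (g (s / d)).2)
    have hk0 : 0 ≤ 2 * d / t := by positivity
    have hk2 : 2 * d / t ≤ 2 := by rw [div_le_iff₀ ht0]; linarith
    have hmem : ∀ s ∈ Set.Icc (0:ℝ) 1, s * (2 * d / t) ∈ Set.Icc (0:ℝ) 2 := fun s hs =>
      ⟨mul_nonneg hs.1 hk0, by nlinarith [hs.1, hs.2]⟩
    classical
    let η : ℝ → Metric.closedBall p 10 := fun s =>
      if h : c (s * (2 * d / t)) ∈ Metric.closedBall p 10 then ⟨_, h⟩ else ⟨q, hqB⟩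
    have hη : ∀ s ∈ Set.Icc (0:ℝ) 1, ((η s : Metric.closedBall p 10) : X) = c (s * (2 * d / t)) := by
      intro s hs
      simp only [η, dif_pos (hcB _ (hmem s hs))]
    have hdist : ∀ s ∈ Set.Icc (0:ℝ) 1, ∀ u ∈ Set.Icc (0:ℝ) 1,
        dist (η s) (η u) = |s - u| * (2 * d / t) := by
      intro s hs u hu
      rw [Subtype.dist_eq, hη s hs, hη u hu, hc _ (hmem s hs) _ (hmem u hu), ← sub_mul, abs_mul,
        abs_of_nonneg hk0]
    have m0 : (0:ℝ) ∈ Set.Icc (0:ℝ) 1 := by simp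
    have m1 : (1:ℝ) ∈ Set.Icc (0:ℝ) 1 := by simp
    have η0 : η 0 = ⟨q, hqB⟩ := by
      apply Subtype.ext
      rw [hη 0 m0, zero_mul, hce 0 ⟨le_rfl, hd0⟩, zero_div, g0]
    refine ⟨η, ⟨η0, rfl, ?_⟩, ?_⟩
    · intro s hs u hu
      rw [hdist s hs u hu, ← η0, hdist 0 m0 1 m1]
      simp
    · rw [hη _ ⟨by positivity, by linarith⟩]
      have : t / 2 * (2 * d / t) = d := by field_simp
      rw [this, hce d ⟨hd0, le_rfl⟩]
      rcases hd0.eq_or_lt with h | h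
      · have hqx : q = x := dist_eq_zero.1 (hd ▸ h.symm)
        rw [← h, div_zero, g0]; exact hqx
      · rw [div_self h.ne', g1]
  haveI : Nonempty (Metric.closedBall p 10) := ⟨⟨q, hqB⟩⟩
  choose! η hη1 hη2 using key
  have hexp : ∀ x ∈ S, ∀ y ∈ S, x ≠ y → 1 ≤ dist (η x 1 : X) (η y 1 : X) := by
    intro x hx y hy hxy
    have h := (hconv _ _ _ _ _ _ (hη1 x hx) (hη1 y hy)).2
      (show (0:ℝ) ∈ Set.Icc (0:ℝ) 1 by simp) (show (1:ℝ) ∈ Set.Icc (0:ℝ) 1 by simp)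
      (show 0 ≤ 1 - t / 2 by linarith) (show 0 ≤ t / 2 by linarith) (by ring)
    simp only [smul_eq_mul, mul_zero, mul_one, zero_add, (hη1 x hx).1, (hη1 y hy).1, dist_self,
      Subtype.dist_eq, hη2 x hx, hη2 y hy] at h
    have h2 := hSsep x hx y hy hxy
    by_contra hlt
    push Not at hlt
    nlinarith
  classical
  have hinj : Set.InjOn (fun x => (η x 1 : X)) S := by
    intro x hx y hy hxy
    by_contra hne
    have := hexp x hx y hy hne
    have hxy' : (η x 1 : X) = (η y 1 : X) := hxy
    rw [hxy', dist_self] at this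
    linarith
  rw [← Finset.card_image_of_injOn hinj]
  apply hL
  · intro z hz
    obtain ⟨x, -, rfl⟩ := Finset.mem_image.1 (Finset.mem_coe.1 hz)
    exact (η x 1).2
  · intro z hz w hw hzw
    obtain ⟨x, hx, rfl⟩ := Finset.mem_image.1 hz
    obtain ⟨y, hy, rfl⟩ := Finset.mem_image.1 hw
    exact hexp x hx y hy (fun h => hzw (by rw [h]))
end

section
/- Let X be a metric space, p ∈ X, and R > 0 such that the closed ball of radius R around p, with the induced metric, is a BNPC space. Suppose there exists a shortest path γ : [0, L] → X with L > 0, γ L = p and image contained in B(p, R), which cannot be extended beyond p: there are no ε > 0 and shortest path η : [0, 2ε] → X with η ε = p and η t = γ (L − ε + t) for all t ∈ [0, ε]. Then for every r with 0 < r ≤ R, the punctured ball {x : X | 0 < dist p x ∧ dist p x < r}, with the subspace topology, is a contractible space. -/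
open Set Metric

/-- Concatenation at `p` extends the path. -/
theorem concat_aux {X : Type*} [MetricSpace X] (p x q : X) (γ τ : ℝ → X) (L δ l : ℝ)
    (hδ : 0 < δ) (hδL : δ ≤ L) (hγ : IsShortestPathOn γ 0 L) (hL : γ L = p)
    (hq : γ (L - δ) = q) (hl : 0 < l)
    (hτ0 : τ 0 = p) (hτ1 : τ 1 = x)
    (hτ : ∀ s ∈ Set.Icc (0:ℝ) 1, ∀ t ∈ Set.Icc (0:ℝ) 1, dist (τ s) (τ t) = |s - t| * l)
    (hqx : dist q x = δ + l) :
    ∃ ε : ℝ, 0 < ε ∧ ∃ η : ℝ → X, IsShortestPathOn η 0 (2 * ε) ∧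
        η ε = p ∧ ∀ t ∈ Set.Icc 0 ε, η t = γ (L - ε + t) := by
  have hε : 0 < min l δ := lt_min hl hδ
  have hεl : min l δ ≤ l := min_le_left _ _
  have hεδ : min l δ ≤ δ := min_le_right _ _
  generalize min l δ = ε at hε hεl hεδ
  have key : ∀ s t : ℝ, 0 ≤ s → s ≤ ε → ε < t → t ≤ 2 * ε →
      dist (γ (L - ε + s)) (τ ((t - ε) / l)) = t - s := by
    intro s t hs hsε hεt ht
    have hm : (t - ε) / l ∈ Set.Icc (0:ℝ) 1 :=
      ⟨div_nonneg (by linarith) hl.le, (div_le_one hl).2 (by linarith)⟩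
    have e : (t - ε) / l * l = t - ε := div_mul_cancel₀ _ hl.ne'
    have h1 := hγ (L - δ) ⟨by linarith, by linarith⟩ (L - ε + s) ⟨by linarith, by linarith⟩
    have h2 := hγ (L - ε + s) ⟨by linarith, by linarith⟩ L ⟨by linarith, by linarith⟩
    have h3 := hτ 0 ⟨le_rfl, zero_le_one⟩ _ hm
    have h4 := hτ _ hm 1 ⟨zero_le_one, le_rfl⟩
    rw [hq, abs_of_nonpos (by linarith)] at h1
    rw [hL, abs_of_nonpos (by linarith)] at h2
    rw [hτ0, abs_of_nonpos (by linarith [hm.1])] at h3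
    rw [hτ1, abs_of_nonpos (by linarith [hm.2])] at h4
    have h5 := dist_triangle4 q (γ (L - ε + s)) (τ ((t - ε) / l)) x
    have h6 := dist_triangle (γ (L - ε + s)) p (τ ((t - ε) / l))
    apply le_antisymm <;> nlinarith
  refine ⟨ε, hε, fun t => if t ≤ ε then γ (L - ε + t) else τ ((t - ε) / l), ?_, ?_, ?_⟩
  · intro s hs t ht
    simp only
    split_ifs with h1 h2 h2
    · rw [hγ _ ⟨by linarith [hs.1], by linarith⟩ _ ⟨by linarith [ht.1], by linarith⟩]
      congr 1; ring
    · rw [key s t hs.1 h1 (not_le.1 h2) ht.2, abs_of_nonpos (by linarith)]; ring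
    · rw [dist_comm, key t s ht.1 h2 (not_le.1 h1) hs.2, abs_of_nonneg (by linarith)]
    · have hm : ∀ u, ¬ u ≤ ε → u ≤ 2 * ε → (u - ε) / l ∈ Set.Icc (0:ℝ) 1 := fun u h h' =>
        ⟨div_nonneg (by linarith) hl.le, (div_le_one hl).2 (by linarith)⟩
      rw [hτ _ (hm s h1 hs.2) _ (hm t h2 ht.2), ← sub_div, abs_div, abs_of_pos hl,
        div_mul_cancel₀ _ hl.ne']
      congr 1; ring
  · simp [hL]
  · intro t ht
    simp [ht.2]

/-- If some shortest path ending at `p` inside a BNPC ball cannot be extended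
beyond `p`, then every punctured ball around `p` is contractible. -/
theorem nonextendable_geodesic_punctured_ball_contractible
    (X : Type*) [MetricSpace X] (p : X) (R : ℝ) (hR : 0 < R)
    (hBNPC : IsBNPC (Metric.closedBall p R))
    (hγ : ∃ (γ : ℝ → X) (L : ℝ), 0 < L ∧ IsShortestPathOn γ 0 L ∧ γ L = p ∧
      (∀ t ∈ Set.Icc 0 L, γ t ∈ Metric.ball p R) ∧
      ¬∃ ε : ℝ, 0 < ε ∧ ∃ η : ℝ → X, IsShortestPathOn η 0 (2 * ε) ∧
        η ε = p ∧ ∀ t ∈ Set.Icc 0 ε, η t = γ (L - ε + t)) :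
    ∀ r : ℝ, 0 < r → r ≤ R →
      ContractibleSpace {x : X | 0 < dist p x ∧ dist p x < r} := by
  obtain ⟨-, hgeo, hconv⟩ := hBNPC
  obtain ⟨γ, L, hL, hγ, hγL, hball, hno⟩ := hγ
  intro r hr hrR
  obtain ⟨δ, hδ, hδL, hδr⟩ : ∃ δ : ℝ, 0 < δ ∧ δ ≤ L ∧ δ < r :=
    ⟨min L (r / 2), lt_min hL (by linarith), min_le_left _ _,
      (min_le_right _ _).trans_lt (by linarith)⟩
  have hpq : dist p (γ (L - δ)) = δ := by
    have := hγ L ⟨hL.le, le_rfl⟩ (L - δ) ⟨by linarith, by linarith⟩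
    rw [hγL, abs_of_nonneg (by linarith)] at this
    linarith
  let P : Metric.closedBall p R := ⟨p, Metric.mem_closedBall_self hR.le⟩
  let Q : Metric.closedBall p R := ⟨γ (L - δ), by
    rw [Metric.mem_closedBall, dist_comm, hpq]; linarith⟩
  have hPQ : dist P Q = δ := hpq
  choose σ hσ using fun x => hgeo x Q
  have hcP : IsGeodesic (fun _ => P) P P := ⟨rfl, rfl, by simp⟩
  -- distance to the center is controlled
  have hlt : ∀ x : Metric.closedBall p R, dist P x < r → ∀ t ∈ Set.Icc (0:ℝ) 1,
      dist P (σ x t) < r := by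
    intro x hx t ht
    have h := (hconv _ _ _ _ _ _ (hσ x) hcP).2 (left_mem_Icc.2 zero_le_one)
      (right_mem_Icc.2 zero_le_one) (show 0 ≤ 1 - t by linarith [ht.2]) ht.1 (by ring)
    simp only [smul_eq_mul, mul_zero, mul_one, zero_add, (hσ x).1, (hσ x).2.1] at h
    rw [dist_comm _ P, dist_comm _ P, dist_comm _ P, hPQ] at h
    rcases ht.1.eq_or_lt with h0 | h0
    · rw [← h0, (hσ x).1]; exact hx
    · nlinarith [ht.2]
  -- the geodesics avoid the center
  have hne : ∀ x : Metric.closedBall p R, 0 < dist P x → ∀ t ∈ Set.Icc (0:ℝ) 1,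
      0 < dist P (σ x t) := by
    intro x hx t ht
    by_contra hcon
    have hPt : σ x t = P := (dist_le_zero.1 (not_lt.1 hcon)).symm
    have h1 := (hσ x).2.2 0 ⟨le_rfl, zero_le_one⟩ t ht
    have h2 := (hσ x).2.2 t ht 1 ⟨zero_le_one, le_rfl⟩
    rw [(hσ x).1, hPt, abs_of_nonpos (by linarith [ht.1])] at h1
    rw [(hσ x).2.1, hPt, abs_of_nonpos (by linarith [ht.2])] at h2
    obtain ⟨τ, hτ0, hτ1, hτ⟩ := hgeo P x
    refine hno (concat_aux p x.1 (γ (L - δ)) γ (fun t => (τ t).1) L δ (dist P x) hδ hδL hγ hγL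
      rfl hx (by simp only [hτ0]; rfl) (by simp only [hτ1]) hτ ?_)
    change dist Q x = _
    rw [dist_comm] at h1
    rw [dist_comm]
    linarith
  have hcont : ∀ (x y : Metric.closedBall p R), ∀ t ∈ Set.Icc (0:ℝ) 1, ∀ s ∈ Set.Icc (0:ℝ) 1,
      dist (σ x t) (σ y s) ≤ dist x y + |t - s| * dist y Q := by
    intro x y t ht s hs
    have h := (hconv _ _ _ _ _ _ (hσ x) (hσ y)).2 (left_mem_Icc.2 zero_le_one)
      (right_mem_Icc.2 zero_le_one) (show 0 ≤ 1 - t by linarith [ht.2]) ht.1 (by ring)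
    simp only [smul_eq_mul, mul_zero, mul_one, zero_add, (hσ x).1, (hσ x).2.1, (hσ y).1,
      (hσ y).2.1, dist_self, add_zero] at h
    have h2 := (hσ y).2.2 t ht s hs
    have h3 := dist_triangle (σ x t) (σ y t) (σ y s)
    have := mul_nonneg ht.1 (dist_nonneg (x := x) (y := y))
    nlinarith
  let ι : {x : X | 0 < dist p x ∧ dist p x < r} → Metric.closedBall p R := fun x =>
    ⟨x.1, by rw [Metric.mem_closedBall, dist_comm]; linarith [x.2.2]⟩
  rw [contractible_iff_id_nullhomotopic]
  refine ⟨⟨γ (L - δ), by rw [Set.mem_ofPred_eq, hpq]; exact ⟨hδ, hδr⟩⟩, ⟨?_⟩⟩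
  refine
    { toFun := fun z => ⟨(σ (ι z.2) z.1).1,
        hne (ι z.2) z.2.2.1 z.1 z.1.2, hlt (ι z.2) z.2.2.2 z.1 z.1.2⟩
      continuous_toFun := ?_
      map_zero_left := ?_
      map_one_left := ?_ }
  · refine Continuous.subtype_mk (continuous_subtype_val.comp ?_) _
    rw [continuous_iff_continuousAt]
    intro z
    rw [ContinuousAt, tendsto_iff_dist_tendsto_zero]
    refine squeeze_zero (fun _ => dist_nonneg)
      (fun w => hcont (ι w.2) (ι z.2) w.1 w.1.2 z.1 z.1.2) ?_
    have hc : Continuous fun w : unitInterval × {x : X | 0 < dist p x ∧ dist p x < r} =>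
        dist w.2.1 z.2.1 + |(w.1:ℝ) - z.1| * dist (ι z.2) Q := by fun_prop
    have := hc.tendsto z
    simp only [dist_self, sub_self, abs_zero, zero_mul, add_zero] at this
    exact this
  · intro x
    apply Subtype.ext
    change (σ (ι x) ((0 : unitInterval) : ℝ)).1 = x.1
    rw [Set.Icc.coe_zero, (hσ (ι x)).1]
  · intro x
    apply Subtype.ext
    change (σ (ι x) ((1 : unitInterval) : ℝ)).1 = γ (L - δ)
    rw [Set.Icc.coe_one, (hσ (ι x)).2.1]
end

section
/- Let X be a complete geodesic metric space such that: (i) any two constant-speed geodesics with the same endpoints coincide on [0,1]; (ii) geodesics depend continuously on their endpoints in the uniform distance: for all x, y ∈ X and ε > 0 there is δ > 0 such that for any constant-speed geodesics γ from x to y and η from x' to y' with dist x x' < δ and dist y y' < δ one has dist (γ t) (η t) < ε for all t ∈ [0,1]; (iii) X is locally BNPC in the sense that every point q has ρ > 0 such that for any two constant-speed geodesics γ, η : [0,1] → X with images contained in B(q, ρ), the function t ↦ dist (γ t) (η t) is convex on [0,1]. Then X is globally BNPC: for any two constant-speed geodesics γ, η : [0,1] → X, the function t ↦ dist (γ t)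 (η t) is convex on [0,1]. -/
open Set Metric

theorem geod_restrict {X : Type*} [MetricSpace X] {γ : ℝ → X} {x y : X}
    (h : IsGeodesic γ x y) {a b : ℝ} (ha : a ∈ Set.Icc (0:ℝ) 1) (hb : b ∈ Set.Icc (0:ℝ) 1) :
    IsGeodesic (fun t => γ ((1 - t) * a + t * b)) (γ a) (γ b) := by
  have key : ∀ t ∈ Set.Icc (0:ℝ) 1, (1 - t) * a + t * b ∈ Set.Icc (0:ℝ) 1 := by
    intro t ht
    have := convex_Icc (0:ℝ) 1 ha hb (sub_nonneg.2 ht.2) ht.1 (by ring)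
    simpa using this
  refine ⟨by simp, by simp, ?_⟩
  intro s hs t ht
  rw [h.2.2 _ (key s hs) _ (key t ht), h.2.2 _ ha _ hb, ← mul_assoc, ← abs_mul]
  congr 1
  rw [← abs_neg]
  congr 1
  ring

theorem geod_cont {X : Type*} [MetricSpace X] {γ : ℝ → X} {x y : X}
    (h : IsGeodesic γ x y) : ContinuousOn γ (Set.Icc (0:ℝ) 1) := by
  have : LipschitzOnWith (nndist x y) γ (Set.Icc (0:ℝ) 1) := by
    apply LipschitzOnWith.of_dist_le_mul
    intro s hs t ht
    rw [h.2.2 s hs t ht, Real.dist_eq, mul_comm]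
    simp
  exact this.continuousOn

/-- Locally midpoint-convex continuous functions lie below the chord. -/
theorem chord_of_local (f : ℝ → ℝ) (hf : ContinuousOn f (Set.Icc (0:ℝ) 1))
    (hm : ∀ m ∈ Set.Ioo (0:ℝ) 1, ∃ e : ℝ, 0 < e ∧ ∀ h, 0 < h → h < e →
      m - h ∈ Set.Icc (0:ℝ) 1 → m + h ∈ Set.Icc (0:ℝ) 1 →
      f m ≤ (f (m - h) + f (m + h)) / 2) :
    ∀ t ∈ Set.Icc (0:ℝ) 1, f t ≤ (1 - t) * f 0 + t * f 1 := by
  intro t ht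
  by_contra! hlt
  set g : ℝ → ℝ := fun t => f t - ((1 - t) * f 0 + t * f 1) with hg
  have hgc : ContinuousOn g (Set.Icc (0:ℝ) 1) := hf.sub (by fun_prop)
  obtain ⟨M, hM, hMmax⟩ := isCompact_Icc.exists_isMaxOn ⟨t, ht⟩ hgc
  have hpos : 0 < g M := lt_of_lt_of_le (by simp only [hg]; linarith) (hMmax ht)
  have hK : IsCompact (Set.Icc (0:ℝ) 1 ∩ g ⁻¹' {g M}) :=
    isCompact_Icc.of_isClosed_subset
      (hgc.preimage_isClosed_of_isClosed isClosed_Icc isClosed_singleton) Set.inter_subset_left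
  obtain ⟨m, ⟨hm01, hmM⟩, hmax⟩ := hK.exists_isGreatest ⟨M, hM, rfl⟩
  have hmM : g m = g M := hmM
  have hm0 : m ≠ 0 := by
    rintro rfl
    simp [hg] at hmM hpos
    linarith
  have hm1 : m ≠ 1 := by
    rintro rfl
    simp [hg] at hmM hpos
    linarith
  have h0 : 0 < m := lt_of_le_of_ne hm01.1 hm0.symm
  have h1 : m < 1 := lt_of_le_of_ne hm01.2 hm1
  obtain ⟨e, he, hE⟩ := hm m ⟨h0, h1⟩
  obtain ⟨h, hh0, hh⟩ := exists_between (show 0 < min e (min m (1 - m)) from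
    lt_min he (lt_min h0 (by linarith)))
  have hh1 := lt_of_lt_of_le hh (min_le_left _ _)
  have hh2 := lt_of_lt_of_le hh ((min_le_right _ _).trans (min_le_left _ _))
  have hh3 := lt_of_lt_of_le hh ((min_le_right _ _).trans (min_le_right _ _))
  have i1 : m - h ∈ Set.Icc (0:ℝ) 1 := ⟨by linarith, by linarith⟩
  have i2 : m + h ∈ Set.Icc (0:ℝ) 1 := ⟨by linarith, by linarith⟩
  have k := hE h hh0 hh1 i1 i2
  have k1 : g (m - h) ≤ g M := hMmax i1
  have k2 : g (m + h) ≤ g M := hMmax i2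
  have k3 : g (m + h) ≠ g M := by
    intro hc
    have := hmax ⟨i2, hc⟩
    linarith
  have k4 := lt_of_le_of_ne k2 k3
  simp only [hg] at k1 k4 hmM
  nlinarith

/-- Chaining over the unit interval. -/
theorem chain_unit (P : ℝ → ℝ → Prop)
    (htr : ∀ a ∈ Set.Icc (0:ℝ) 1, ∀ b ∈ Set.Icc (0:ℝ) 1, ∀ c ∈ Set.Icc (0:ℝ) 1, a ≤ b → b ≤ c →
      P a b → P b c → P a c)
    (hloc : ∀ s ∈ Set.Icc (0:ℝ) 1, ∃ e : ℝ, 0 < e ∧ ∀ a ∈ Set.Icc (0:ℝ) 1,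
      ∀ b ∈ Set.Icc (0:ℝ) 1, a ≤ b → dist a s < e → dist b s < e → P a b) : P 0 1 := by
  choose! e he hP using hloc
  obtain ⟨t, ht0, htm, ⟨m, hm⟩, hc⟩ := exists_monotone_Icc_subset_open_cover_Icc
    (zero_le_one (α := ℝ)) (c := fun s : Set.Icc (0:ℝ) 1 => Metric.ball s (e s))
    (fun s => Metric.isOpen_ball)
    (fun s _ => Set.mem_iUnion.2 ⟨s, Metric.mem_ball_self (he s s.2)⟩)
  have hstep : ∀ n, P (t n) (t (n + 1)) := by
    intro n
    obtain ⟨s, hs⟩ := hc n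
    have hle := htm (Nat.le_succ n)
    exact hP s s.2 _ (t n).2 _ (t (n+1)).2 hle (hs ⟨le_rfl, hle⟩) (hs ⟨hle, le_rfl⟩)
  have hall : ∀ n, P (t 0) (t (n + 1)) := by
    intro n
    induction n with
    | zero => exact hstep 0
    | succ n ih =>
      exact htr _ (t 0).2 _ (t (n+1)).2 _ (t (n+1+1)).2 (htm (Nat.zero_le _))
        (htm (Nat.le_succ _)) ih (hstep _)
  have := hall m
  rw [ht0, hm (m + 1) (Nat.le_succ m)] at this
  exact this

/-- Globalization: a complete geodesic space with unique geodesics depending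
continuously on endpoints which is locally BNPC is globally BNPC. -/
theorem locally_bnpc_globalization
    (X : Type*) [MetricSpace X] [CompleteSpace X]
    (hGeo : IsGeodesicSpace X)
    (hUnique : ∀ (x y : X) (γ η : ℝ → X), IsGeodesic γ x y → IsGeodesic η x y →
      ∀ t ∈ Set.Icc (0:ℝ) 1, γ t = η t)
    (hCont : ∀ (x y : X) (ε : ℝ), 0 < ε → ∃ δ : ℝ, 0 < δ ∧
      ∀ (x' y' : X) (γ η : ℝ → X), IsGeodesic γ x y → IsGeodesic η x' y' →
        dist x x' < δ → dist y y' < δ →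
        ∀ t ∈ Set.Icc (0:ℝ) 1, dist (γ t) (η t) < ε)
    (hLoc : ∀ q : X, ∃ ρ : ℝ, 0 < ρ ∧
      ∀ (γ η : ℝ → X) (x y x' y' : X), IsGeodesic γ x y → IsGeodesic η x' y' →
        (∀ t ∈ Set.Icc (0:ℝ) 1, γ t ∈ Metric.ball q ρ) →
        (∀ t ∈ Set.Icc (0:ℝ) 1, η t ∈ Metric.ball q ρ) →
        ConvexOn ℝ (Set.Icc (0:ℝ) 1) (fun t => dist (γ t) (η t))) :
    ∀ (γ η : ℝ → X) (x y x' y' : X), IsGeodesic γ x y → IsGeodesic η x' y' →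
      ConvexOn ℝ (Set.Icc (0:ℝ) 1) (fun t => dist (γ t) (η t)) := by
  -- Step 1: geodesics near a given one satisfy the chord inequality
  have step1 : ∀ x y : X, ∃ δ : ℝ, 0 < δ ∧ ∀ (x₁ y₁ x₂ y₂ : X) (σ τ : ℝ → X),
      IsGeodesic σ x₁ y₁ → IsGeodesic τ x₂ y₂ → dist x x₁ < δ → dist y y₁ < δ →
      dist x x₂ < δ → dist y y₂ < δ → ∀ t ∈ Set.Icc (0:ℝ) 1,
      dist (σ t) (τ t) ≤ (1 - t) * dist x₁ x₂ + t * dist y₁ y₂ := by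
    intro x y
    obtain ⟨γ, hγ⟩ := hGeo x y
    choose ρ hρ hconv using hLoc
    obtain ⟨ε, hε, hleb⟩ := lebesgue_number_lemma_of_metric
      (isCompact_Icc.image_of_continuousOn (geod_cont hγ))
      (c := fun q => Metric.ball q (ρ q)) (fun q => Metric.isOpen_ball)
      (fun q _ => Set.mem_iUnion.2 ⟨q, Metric.mem_ball_self (hρ q)⟩)
    obtain ⟨δ, hδ, hδ'⟩ := hCont x y ε hε
    refine ⟨δ, hδ, ?_⟩
    intro x₁ y₁ x₂ y₂ σ τ hσ hτ d1 d2 d3 d4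
    have hch := chord_of_local (fun t => dist (σ t) (τ t))
      (continuous_dist.comp_continuousOn ((geod_cont hσ).prodMk (geod_cont hτ))) ?_
    · intro t ht
      have := hch t ht
      simpa only [hσ.1, hσ.2.1, hτ.1, hτ.2.1] using this
    intro m hm
    have hmI : m ∈ Set.Icc (0:ℝ) 1 := Set.Ioo_subset_Icc_self hm
    obtain ⟨q, hq⟩ := hleb (γ m) ⟨m, hmI, rfl⟩
    have near : ∀ (z w : X) (κ : ℝ → X), IsGeodesic κ z w → dist x z < δ → dist y w < δ →
        ∃ e : ℝ, 0 < e ∧ ∀ u ∈ Set.Icc (0:ℝ) 1, dist u m < e → κ u ∈ Metric.ball q (ρ q) := by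
      intro z w κ hκ hz hw
      have hin : κ m ∈ Metric.ball q (ρ q) := hq (by
        rw [Metric.mem_ball, dist_comm]
        exact hδ' z w γ κ hγ hκ hz hw m hmI)
      have hev := (geod_cont hκ m hmI).eventually (Metric.isOpen_ball.mem_nhds hin)
      obtain ⟨e, he, h⟩ := Metric.mem_nhdsWithin_iff.1 hev
      exact ⟨e, he, fun u hu hd => h ⟨hd, hu⟩⟩
    obtain ⟨e1, he1, H1⟩ := near _ _ σ hσ d1 d2
    obtain ⟨e2, he2, H2⟩ := near _ _ τ hτ d3 d4
    refine ⟨min e1 e2, lt_min he1 he2, ?_⟩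
    intro h h0 hlt i1 i2
    have hlt1 := lt_of_lt_of_le hlt (min_le_left _ _)
    have hlt2 := lt_of_lt_of_le hlt (min_le_right _ _)
    have hpt : ∀ t ∈ Set.Icc (0:ℝ) 1, (1 - t) * (m - h) + t * (m + h) ∈ Set.Icc (0:ℝ) 1 ∧
        dist ((1 - t) * (m - h) + t * (m + h)) m ≤ h := by
      intro t ht
      constructor
      · have := convex_Icc (0:ℝ) 1 i1 i2 (sub_nonneg.2 ht.2) ht.1 (by ring)
        simpa using this
      · rw [Real.dist_eq, abs_le]
        constructor <;> nlinarith [ht.1, ht.2]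
    have hc := hconv q _ _ _ _ _ _ (geod_restrict hσ i1 i2) (geod_restrict hτ i1 i2)
      (fun t ht => H1 _ (hpt t ht).1 (lt_of_le_of_lt (hpt t ht).2 hlt1))
      (fun t ht => H2 _ (hpt t ht).1 (lt_of_le_of_lt (hpt t ht).2 hlt2))
    have := hc.2 (show (0:ℝ) ∈ Set.Icc (0:ℝ) 1 by simp) (show (1:ℝ) ∈ Set.Icc (0:ℝ) 1 by simp)
      (show (0:ℝ) ≤ 1/2 by norm_num) (show (0:ℝ) ≤ 1/2 by norm_num) (by norm_num)
    have e1 : (1 - (1/2:ℝ)) * (m - h) + (1/2) * (m + h) = m := by ring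
    simp only [smul_eq_mul, mul_zero, mul_one, zero_add, e1, sub_zero, one_mul, zero_mul,
      add_zero, sub_self] at this
    linarith
  -- Step 2: the chord inequality for arbitrary pairs of geodesics
  have step2 : ∀ (γ η : ℝ → X) (x y x' y' : X), IsGeodesic γ x y → IsGeodesic η x' y' →
      ∀ t ∈ Set.Icc (0:ℝ) 1, dist (γ t) (η t) ≤ (1 - t) * dist x x' + t * dist y y' := by
    intro γ η x y x' y' hγ hη
    obtain ⟨α, hα⟩ := hGeo x x'
    obtain ⟨β, hβ⟩ := hGeo y y'
    have := chain_unit (fun a b => ∀ σ τ : ℝ → X, IsGeodesic σ (α a) (β a) →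
      IsGeodesic τ (α b) (β b) → ∀ t ∈ Set.Icc (0:ℝ) 1,
      dist (σ t) (τ t) ≤ (b - a) * ((1 - t) * dist x x' + t * dist y y')) ?_ ?_
    · have := this γ η (by rwa [hα.1, hβ.1]) (by rwa [hα.2.1, hβ.2.1])
      simpa using this
    · intro a ha b hb c hc hab hbc h1 h2 σ τ hσ hτ t ht
      obtain ⟨κ, hκ⟩ := hGeo (α b) (β b)
      have := dist_triangle (σ t) (κ t) (τ t)
      have := h1 σ κ hσ hκ t ht
      have := h2 κ τ hκ hτ t ht
      linarith
    · intro s hs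
      obtain ⟨δ, hδ, H⟩ := step1 (α s) (β s)
      obtain ⟨e1, he1, H1⟩ := Metric.continuousOn_iff.1 (geod_cont hα) s hs δ hδ
      obtain ⟨e2, he2, H2⟩ := Metric.continuousOn_iff.1 (geod_cont hβ) s hs δ hδ
      refine ⟨min e1 e2, lt_min he1 he2, ?_⟩
      intro a ha b hb hab hda hdb σ τ hσ hτ t ht
      have := H _ _ _ _ σ τ hσ hτ
        (by rw [dist_comm]; exact H1 a ha (hda.trans_le (min_le_left _ _)))
        (by rw [dist_comm]; exact H2 a ha (hda.trans_le (min_le_right _ _)))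
        (by rw [dist_comm]; exact H1 b hb (hdb.trans_le (min_le_left _ _)))
        (by rw [dist_comm]; exact H2 b hb (hdb.trans_le (min_le_right _ _))) t ht
      rw [hα.2.2 a ha b hb, hβ.2.2 a ha b hb, abs_sub_comm, abs_of_nonneg (sub_nonneg.2 hab)]
        at this
      linarith
  -- Step 3: restrict to subsegments
  intro γ η x y x' y' hγ hη
  refine ⟨convex_Icc 0 1, ?_⟩
  intro u hu v hv a b ha hb hab
  have := step2 _ _ _ _ _ _ (geod_restrict hγ hu hv) (geod_restrict hη hu hv) b
    ⟨hb, by linarith⟩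
  have e : 1 - b = a := by linarith
  simpa only [e, smul_eq_mul] using this
end

section
/- Let X be a locally compact metric space, let Y be a metric space in which every point has a neighborhood U such that any two points of U are joined by a constant-speed geodesic of Y, let f : X → Y be continuous, and let ε > 0. Assume: for every x ∈ X there is ρ > 0 such that for every v ∈ Y with 0 < dist (f x) v < ρ there exists y ∈ X with y ≠ x and dist (f y) v − dist (f x) v ≤ −ε * dist x y. Then f is ε-open: for every x ∈ X there exists r > 0 such that for every v ∈ Y with dist (f x) v < r there exists y ∈ X with f y = v and ε * dist x y ≤ dist (f x) v. -/
open Set Metric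

/-- Openness criterion: a continuous map from a locally compact space to a
locally geodesic space which decreases the distance to nearby targets at a
definite rate is ε-open. -/
theorem eps_open_criterion
    (X Y : Type*) [MetricSpace X] [MetricSpace Y] [LocallyCompactSpace X]
    (hY : ∀ y : Y, ∃ U ∈ nhds y, ∀ a ∈ U, ∀ b ∈ U,
      ∃ γ : ℝ → Y, IsGeodesic γ a b)
    (f : X → Y) (hf : Continuous f) (ε : ℝ) (hε : 0 < ε)
    (hdec : ∀ x : X, ∃ ρ : ℝ, 0 < ρ ∧ ∀ v : Y,
      0 < dist (f x) v → dist (f x) v < ρ →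
      ∃ y : X, y ≠ x ∧ dist (f y) v - dist (f x) v ≤ -(ε * dist x y)) :
    ∀ x : X, ∃ r : ℝ, 0 < r ∧ ∀ v : Y, dist (f x) v < r →
      ∃ y : X, f y = v ∧ ε * dist x y ≤ dist (f x) v := by
  intro x
  obtain ⟨U, hU, hgeo⟩ := hY (f x)
  obtain ⟨s, hs, hsU⟩ := Metric.mem_nhds_iff.1 hU
  obtain ⟨K, hK, hKx⟩ := exists_compact_mem_nhds x
  obtain ⟨R, hR, hRK⟩ := Metric.nhds_basis_closedBall.mem_iff.1 hKx
  refine ⟨min (ε * R) (s / 2), lt_min (by positivity) (by positivity), fun v hv => ?_⟩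
  have hv1 : dist (f x) v < ε * R := lt_of_lt_of_le hv (min_le_left _ _)
  have hv2 : dist (f x) v < s / 2 := lt_of_lt_of_le hv (min_le_right _ _)
  have hA : IsClosed {y : X | dist (f y) v + ε * dist x y ≤ dist (f x) v} :=
    isClosed_le (by fun_prop) continuous_const
  have hAK : {y : X | dist (f y) v + ε * dist x y ≤ dist (f x) v} ⊆ K := by
    intro y hy
    have hy' : dist (f y) v + ε * dist x y ≤ dist (f x) v := hy
    apply hRK
    rw [Metric.mem_closedBall, dist_comm]
    have h0 : 0 ≤ dist (f y) v := dist_nonneg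
    have h1 : ε * dist x y < ε * R := by linarith
    exact (lt_of_mul_lt_mul_left h1 hε.le).le
  have hAc := hK.of_isClosed_subset hA hAK
  obtain ⟨y, hy, hmin⟩ := hAc.exists_isMinOn ⟨x, by simp⟩
    (f := fun y => dist (f y) v) (by fun_prop)
  have hy' : dist (f y) v + ε * dist x y ≤ dist (f x) v := hy
  have hexy : 0 ≤ ε * dist x y := by positivity
  by_cases hfy : f y = v
  · exact ⟨y, hfy, by rw [hfy, dist_self] at hy'; linarith⟩
  exfalso
  have hD : 0 < dist (f y) v := dist_pos.2 hfy
  have hyU : f y ∈ U := by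
    apply hsU
    rw [Metric.mem_ball]
    have := dist_triangle_right (f y) (f x) v
    linarith
  have hvU : v ∈ U := by
    apply hsU
    rw [Metric.mem_ball, dist_comm]
    linarith
  obtain ⟨γ, h0, h1, hγ⟩ := hgeo _ hyU _ hvU
  obtain ⟨ρ, hρ, hd⟩ := hdec y
  obtain ⟨t, ht0, ht1, htρ⟩ : ∃ t : ℝ, 0 < t ∧ t ≤ 1 ∧ t * dist (f y) v < ρ := by
    refine ⟨min 1 (ρ / 2 / dist (f y) v), lt_min one_pos (by positivity), min_le_left _ _, ?_⟩
    calc _ ≤ ρ / 2 / dist (f y) v * dist (f y) v := by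
          gcongr
          exact min_le_right _ _
      _ = ρ / 2 := by field_simp
      _ < ρ := by linarith
  have e1 : dist (f y) (γ t) = t * dist (f y) v := by
    have := hγ 0 ⟨le_rfl, zero_le_one⟩ t ⟨ht0.le, ht1⟩
    rwa [h0, zero_sub, abs_neg, abs_of_pos ht0] at this
  have e2 : dist (γ t) v = (1 - t) * dist (f y) v := by
    have := hγ t ⟨ht0.le, ht1⟩ 1 ⟨zero_le_one, le_rfl⟩
    rwa [h1, abs_sub_comm, abs_of_nonneg (by linarith)] at this
  obtain ⟨z, hzy, hz⟩ := hd (γ t) (by rw [e1]; positivity) (by rwa [e1])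
  have hpos : 0 < ε * dist y z := mul_pos hε (dist_pos.2 hzy.symm)
  have htri := dist_triangle (f z) (γ t) v
  have hzv : dist (f z) v ≤ dist (f y) v - ε * dist y z := by
    rw [e1] at hz
    rw [e2] at htri
    linarith
  have hxz : ε * dist x z ≤ ε * dist x y + ε * dist y z := by
    rw [← mul_add]
    exact mul_le_mul_of_nonneg_left (dist_triangle _ _ _) hε.le
  have hzA : z ∈ {y : X | dist (f y) v + ε * dist x y ≤ dist (f x) v} := by
    show dist (f z) v + ε * dist x z ≤ dist (f x) v
    linarith
  have : dist (f y) v ≤ dist (f z) v := hmin hzA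
  linarith
end

section
/- Let X be a metric space and p ∈ X such that the closed ball of radius 10 around p, with the induced metric, is a compact BNPC space, and such that every shortest path γ : [0, ℓ] → X with γ 0 = p, image contained in the closed ball of radius 10 around p, and ℓ < 2, extends to a shortest path γ̄ : [0, 2] → X with image in that closed ball and γ̄ t = γ t for t ∈ [0, ℓ]. Then for every ε > 0 there exist δ > 0 and r₀ with 0 < r₀ < 1 such that the following holds: for all r with 0 < r < r₀, all x, y ∈ X with dist p x = r, dist x y < δ * r and y ≠ p, and all z, w ∈ X satisfying dist p z = 2 * dist p x, dist p x + dist x z = dist p z, dist p w = 2 * dist p y, and dist p y + dist y w = dist p w, one has dist z w < ε * r. -/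
open Set Metric

lemma bn_mono {Y : Type*} [MetricSpace Y] (hY : IsBNPC Y) {p a b : Y} {c c' : ℝ → Y}
    (hc : IsGeodesic c p a) (hc' : IsGeodesic c' p b) {s t : ℝ} (hs : 0 ≤ s) (hst : s ≤ t)
    (ht0 : 0 < t) (ht : t ≤ 1) :
    t * dist (c s) (c' s) ≤ s * dist (c t) (c' t) := by
  have h := (hY.2.2 c c' p a p b hc hc').2 (show (0:ℝ) ∈ Set.Icc (0:ℝ) 1 by simp)
    (show t ∈ Set.Icc (0:ℝ) 1 from ⟨ht0.le, ht⟩)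
    (show 0 ≤ 1 - s / t by rw [sub_nonneg, div_le_one ht0]; exact hst)
    (show 0 ≤ s / t by positivity) (by ring)
  have e : s / t * t = s := by field_simp
  simp only [smul_eq_mul, mul_zero, zero_add, e, hc.1, hc'.1, dist_self] at h
  calc t * dist (c s) (c' s) ≤ t * (s / t * dist (c t) (c' t)) :=
        mul_le_mul_of_nonneg_left h ht0.le
    _ = s * dist (c t) (c' t) := by field_simp

lemma bn_pair (f : ℝ → ℝ) (h0 : ∀ t, 0 ≤ f t)
    (hf : ∀ s t, 0 ≤ s → s ≤ t → 0 < t → t ≤ 1 → t * f s ≤ s * f t) (ε : ℝ) (hε : 0 < ε) :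
    ∃ t0 : ℝ, 0 < t0 ∧ t0 ≤ 1 / 2 ∧ ∀ t, 0 < t → t < t0 → f (2 * t) ≤ 2 * f t + ε * t := by
  set S := (fun t => f t / t) '' Set.Ioc (0:ℝ) 1
  have hb : BddBelow S := ⟨0, by
    rintro _ ⟨t, ht, rfl⟩
    exact div_nonneg (h0 t) ht.1.le⟩
  have hne : S.Nonempty := ⟨_, 1, ⟨one_pos, le_rfl⟩, rfl⟩
  obtain ⟨_, ⟨t1, ht1, rfl⟩, h1⟩ := exists_lt_of_csInf_lt hne
    (show sInf S < sInf S + ε / 2 by linarith)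
  have ht1' := ht1.1
  have ht1'' := ht1.2
  refine ⟨t1 / 2, by linarith, by linarith, fun t ht htt => ?_⟩
  have h2 : sInf S ≤ f t / t := csInf_le hb ⟨t, ⟨ht, by linarith⟩, rfl⟩
  have h3 := hf (2 * t) t1 (by linarith) (by linarith) ht1' ht1''
  have h4 : f t1 / t1 < f t / t + ε / 2 := by dsimp only at h1; linarith
  have h5 : f (2 * t) ≤ 2 * t * (f t1 / t1) := by
    rw [← mul_div_assoc, le_div_iff₀ ht1']; linarith
  have h6 : 2 * t * (f t1 / t1) ≤ 2 * t * (f t / t + ε / 2) :=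
    mul_le_mul_of_nonneg_left h4.le (by linarith)
  have h7 : 2 * t * (f t / t + ε / 2) = 2 * f t + ε * t := by field_simp
  linarith

lemma bn_unif {Y : Type*} [MetricSpace Y] [CompactSpace Y] (hY : IsBNPC Y) (p : Y)
    (ε : ℝ) (hε : 0 < ε) :
    ∃ t0 : ℝ, 0 < t0 ∧ t0 ≤ 1 / 2 ∧ ∀ t, 0 < t → t < t0 → ∀ (c c' : ℝ → Y) (a b : Y),
      IsGeodesic c p a → IsGeodesic c' p b →
      dist (c (2 * t)) (c' (2 * t)) ≤ 2 * dist (c t) (c' t) + ε * t := by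
  choose G hG using fun a : Y => hY.2.1 p a
  obtain ⟨N, -, hNf, hN⟩ := finite_cover_balls_of_compact (isCompact_univ (X := Y))
    (show 0 < ε / 16 by linarith)
  choose T hT0 hT1 hT using fun q : Y × Y =>
    bn_pair (fun t => dist (G q.1 t) (G q.2 t)) (fun _ => dist_nonneg)
      (fun s t h1 h2 h3 h4 => bn_mono hY (hG q.1) (hG q.2) h1 h2 h3 h4) (ε / 2) (by linarith)
  obtain ⟨t0, h0, h1, h2⟩ : ∃ t0 : ℝ, 0 < t0 ∧ t0 ≤ 1 / 2 ∧ ∀ q ∈ N ×ˢ N, t0 ≤ T q := by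
    have hf := hNf.prod hNf
    rcases (N ×ˢ N).eq_empty_or_nonempty with he | hne
    · exact ⟨1 / 2, by norm_num, le_rfl, by simp [he]⟩
    · obtain ⟨q, -, hq⟩ := Set.exists_min_image _ T hf hne
      exact ⟨T q, hT0 q, hT1 q, hq⟩
  refine ⟨t0, h0, h1, fun t ht htt c c' a b hc hc' => ?_⟩
  have near : ∀ a : Y, ∃ i ∈ N, dist a i < ε / 16 := fun a => by
    simpa using hN (Set.mem_univ a)
  obtain ⟨i, hi, hai⟩ := near a
  obtain ⟨j, hj, hbj⟩ := near b
  have key := hT (i, j) t ht (htt.trans_le (h2 (i, j) ⟨hi, hj⟩))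
  dsimp only at key
  have cl : ∀ (c : ℝ → Y) (a i : Y), IsGeodesic c p a → dist a i < ε / 16 →
      ∀ s, 0 ≤ s → s ≤ 1 → dist (c s) (G i s) ≤ s * (ε / 16) := by
    intro c a i hc hai s hs hs1
    have := bn_mono hY hc (hG i) hs hs1 one_pos le_rfl
    rw [hc.2.1, (hG i).2.1, one_mul] at this
    exact this.trans (mul_le_mul_of_nonneg_left hai.le hs)
  have a1 := cl c a i hc hai t ht.le (by linarith)
  have a2 := cl c a i hc hai (2 * t) (by linarith) (by linarith)
  have b1 := cl c' b j hc' hbj t ht.le (by linarith)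
  have b2 := cl c' b j hc' hbj (2 * t) (by linarith) (by linarith)
  have u := dist_triangle4 (c (2 * t)) (G i (2 * t)) (G j (2 * t)) (c' (2 * t))
  have v := dist_triangle4 (G i t) (c t) (c' t) (G j t)
  rw [dist_comm (G j (2 * t))] at u
  rw [dist_comm (G i t) (c t)] at v
  nlinarith

lemma bn_ext (X : Type*) [MetricSpace X] (p : X)
    (hBNPC : IsBNPC (Metric.closedBall p 10))
    (hExt : ∀ (γ : ℝ → X) (ℓ : ℝ), 0 ≤ ℓ → ℓ < 2 → IsShortestPathOn γ 0 ℓ →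
      γ 0 = p →
      (∀ t ∈ Set.Icc 0 ℓ, γ t ∈ Metric.closedBall p 10) →
      ∃ γ' : ℝ → X, IsShortestPathOn γ' 0 2 ∧
        (∀ t ∈ Set.Icc (0:ℝ) 2, γ' t ∈ Metric.closedBall p 10) ∧
        ∀ t ∈ Set.Icc 0 ℓ, γ' t = γ t)
    (x z : X) (r : ℝ) (hr : 0 < r) (hr1 : r < 1) (hx : dist p x = r)
    (hz : dist p z = 2 * dist p x) (hxz : dist p x + dist x z = dist p z) :
    ∃ (p' a : Metric.closedBall p 10) (c : ℝ → Metric.closedBall p 10),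
      (p' : X) = p ∧ IsGeodesic c p' a ∧ dist p' a = 2 ∧
      (c (r / 2) : X) = x ∧ (c r : X) = z := by
  have hxz' : dist x z = r := by linarith
  have hz' : dist p z = 2 * r := by linarith
  have hpm : p ∈ Metric.closedBall p 10 := by simp
  have hxm : x ∈ Metric.closedBall p 10 := by rw [mem_closedBall, dist_comm]; linarith
  have hzm : z ∈ Metric.closedBall p 10 := by rw [mem_closedBall, dist_comm]; linarith
  obtain ⟨c1, h10, h11, h1⟩ := hBNPC.2.1 ⟨p, hpm⟩ ⟨x, hxm⟩
  obtain ⟨c2, h20, h21, h2⟩ := hBNPC.2.1 ⟨x, hxm⟩ ⟨z, hzm⟩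
  simp only [Subtype.dist_eq, hx, hxz'] at h1 h2
  have scale : ∀ u v : ℝ, |u / r - v / r| * r = |u - v| := by
    intro u v
    rw [← sub_div, abs_div, abs_of_pos hr]; field_simp
  have d1 : ∀ s ∈ Set.Icc 0 r, ∀ t ∈ Set.Icc 0 r,
      dist (c1 (s / r) : X) (c1 (t / r)) = |s - t| := by
    intro s hs t ht
    rw [h1 _ ⟨div_nonneg hs.1 hr.le, (div_le_one hr).2 hs.2⟩ _
      ⟨div_nonneg ht.1 hr.le, (div_le_one hr).2 ht.2⟩, scale]
  have d2 : ∀ s ∈ Set.Icc 0 r, ∀ t ∈ Set.Icc 0 r,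
      dist (c2 (s / r) : X) (c2 (t / r)) = |s - t| := by
    intro s hs t ht
    rw [h2 _ ⟨div_nonneg hs.1 hr.le, (div_le_one hr).2 hs.2⟩ _
      ⟨div_nonneg ht.1 hr.le, (div_le_one hr).2 ht.2⟩, scale]
  have e1 : c1 (0 / r) = ⟨p, hpm⟩ := by rw [zero_div, h10]
  have e1' : c1 (r / r) = ⟨x, hxm⟩ := by rw [div_self hr.ne', h11]
  have e2 : c2 (0 / r) = ⟨x, hxm⟩ := by rw [zero_div, h20]
  have e2' : c2 (r / r) = ⟨z, hzm⟩ := by rw [div_self hr.ne', h21]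
  have zm : (0:ℝ) ∈ Set.Icc 0 r := ⟨le_rfl, hr.le⟩
  have rm : r ∈ Set.Icc 0 r := ⟨hr.le, le_rfl⟩
  have cross : ∀ s ∈ Set.Icc 0 r, ∀ t ∈ Set.Icc 0 r,
      dist (c1 (s / r) : X) (c2 (t / r)) = t + r - s := by
    intro s hs t ht
    have A := d1 0 zm s hs
    have B := d1 s hs r rm
    have C := d2 0 zm t ht
    have D := d2 t ht r rm
    rw [e1, zero_sub, abs_neg, abs_of_nonneg hs.1] at A
    rw [e1', abs_sub_comm, abs_of_nonneg (by linarith [hs.2])] at B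
    rw [e2, zero_sub, abs_neg, abs_of_nonneg ht.1] at C
    rw [e2', abs_sub_comm, abs_of_nonneg (by linarith [ht.2])] at D
    have t1 := dist_triangle (c1 (s / r) : X) x (c2 (t / r))
    have t2 := dist_triangle4 p (c1 (s / r) : X) (c2 (t / r)) z
    dsimp only at A B C D
    linarith
  let γ : ℝ → X := fun t => if t ≤ r then c1 (t / r) else c2 ((t - r) / r)
  have hγ : IsShortestPathOn γ 0 (2 * r) := by
    intro s hs t ht
    obtain ⟨hs0, hs1⟩ := hs
    obtain ⟨ht0, ht1⟩ := ht
    simp only [γ]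
    split_ifs with hA hB hB
    · exact d1 s ⟨hs0, hA⟩ t ⟨ht0, hB⟩
    · push Not at hB
      rw [cross s ⟨hs0, hA⟩ (t - r) ⟨by linarith, by linarith⟩, abs_sub_comm,
        abs_of_nonneg (by linarith)]
      ring
    · push Not at hA
      rw [dist_comm, cross t ⟨ht0, hB⟩ (s - r) ⟨by linarith, by linarith⟩,
        abs_of_nonneg (by linarith)]
      ring
    · push Not at hA hB
      rw [d2 (s - r) ⟨by linarith, by linarith⟩ (t - r) ⟨by linarith, by linarith⟩]
      congr 1; ring
  have γ0 : γ 0 = p := by simp only [γ, if_pos hr.le, e1]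
  have γr : γ r = x := by simp only [γ, if_pos le_rfl, e1']
  have γ2 : γ (2 * r) = z := by
    simp only [γ]
    rw [if_neg (by linarith), show 2 * r - r = r by ring, e2']
  obtain ⟨γ', g1, g2, g3⟩ := hExt γ (2 * r) (by linarith) (by linarith) hγ γ0 (by
    intro t _
    simp only [γ]
    split_ifs
    · exact (c1 _).2
    · exact (c2 _).2)
  let c : ℝ → Metric.closedBall p 10 := fun t =>
    if h : 2 * t ∈ Set.Icc (0:ℝ) 2 then ⟨γ' (2 * t), g2 _ h⟩ else ⟨p, hpm⟩
  have hc : ∀ t ∈ Set.Icc (0:ℝ) 1, (c t : X) = γ' (2 * t) := by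
    intro t ht
    have : 2 * t ∈ Set.Icc (0:ℝ) 2 := ⟨by linarith [ht.1], by linarith [ht.2]⟩
    simp only [c, dif_pos this]
  have i0 : (0:ℝ) ∈ Set.Icc (0:ℝ) 1 := by simp
  have i1 : (1:ℝ) ∈ Set.Icc (0:ℝ) 1 := by simp
  have hd : ∀ s ∈ Set.Icc (0:ℝ) 1, ∀ t ∈ Set.Icc (0:ℝ) 1, dist (c s) (c t) = |s - t| * 2 := by
    intro s hs t ht
    rw [Subtype.dist_eq, hc s hs, hc t ht,
      g1 _ ⟨by linarith [hs.1], by linarith [hs.2]⟩ _ ⟨by linarith [ht.1], by linarith [ht.2]⟩,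
      ← mul_sub, abs_mul, abs_two, mul_comm]
  have h01 : dist (c 0) (c 1) = 2 := by rw [hd 0 i0 1 i1]; norm_num
  refine ⟨c 0, c 1, c, ?_, ⟨rfl, rfl, ?_⟩, h01, ?_, ?_⟩
  · rw [hc 0 i0, mul_zero, g3 0 ⟨le_rfl, by linarith⟩, γ0]
  · rw [h01]; exact hd
  · rw [hc _ ⟨by linarith, by linarith⟩, show 2 * (r / 2) = r by ring,
      g3 r ⟨by linarith, by linarith⟩, γr]
  · rw [hc _ ⟨by linarith, by linarith⟩, g3 _ ⟨by linarith, by linarith⟩, γ2]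

/-- Almost nonbranching: in a tiny ball, geodesics emanating from the center
which start close together stay close after doubling their length. -/
theorem almost_nonbranching
    (X : Type*) [MetricSpace X] (p : X)
    (hCpt : CompactSpace (Metric.closedBall p 10))
    (hBNPC : IsBNPC (Metric.closedBall p 10))
    (hExt : ∀ (γ : ℝ → X) (ℓ : ℝ), 0 ≤ ℓ → ℓ < 2 → IsShortestPathOn γ 0 ℓ →
      γ 0 = p →
      (∀ t ∈ Set.Icc 0 ℓ, γ t ∈ Metric.closedBall p 10) →
      ∃ γ' : ℝ → X, IsShortestPathOn γ' 0 2 ∧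
        (∀ t ∈ Set.Icc (0:ℝ) 2, γ' t ∈ Metric.closedBall p 10) ∧
        ∀ t ∈ Set.Icc 0 ℓ, γ' t = γ t) :
    ∀ ε : ℝ, 0 < ε → ∃ δ r₀ : ℝ, 0 < δ ∧ 0 < r₀ ∧ r₀ < 1 ∧
      ∀ r : ℝ, 0 < r → r < r₀ → ∀ x y z w : X,
        dist p x = r → dist x y < δ * r → y ≠ p →
        dist p z = 2 * dist p x → dist p x + dist x z = dist p z →
        dist p w = 2 * dist p y → dist p y + dist y w = dist p w →
        dist z w < ε * r := by
  intro ε hε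
  obtain ⟨t0, ht0, ht1, ht⟩ := bn_unif hBNPC ⟨p, by simp⟩ (ε / 2) (by linarith)
  refine ⟨min (1 / 2) (ε / 12), t0, by positivity, ht0, by linarith, ?_⟩
  intro r hr hrt x y z w hx hxy hyp hz hxz hw hyw
  have k1 : dist x y < 1 / 2 * r :=
    hxy.trans_le (mul_le_mul_of_nonneg_right (min_le_left _ _) hr.le)
  have k2 : dist x y < ε / 12 * r :=
    hxy.trans_le (mul_le_mul_of_nonneg_right (min_le_right _ _) hr.le)
  have hs : 0 < dist p y := dist_pos.2 (Ne.symm hyp)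
  have hs1 := dist_triangle p x y
  have hs2 := dist_triangle p y x
  rw [dist_comm y x] at hs2
  obtain ⟨p1, a, c, hp1, hc, hca, hcx, hcz⟩ :=
    bn_ext X p hBNPC hExt x z r hr (by linarith) hx hz hxz
  obtain ⟨p2, b, c', hp2, hc', hcb, hcy, hcw⟩ :=
    bn_ext X p hBNPC hExt y w (dist p y) hs (by linarith) rfl hw hyw
  obtain rfl : p1 = ⟨p, by simp⟩ := Subtype.ext hp1
  obtain rfl : p2 = ⟨p, by simp⟩ := Subtype.ext hp2
  have key := ht (r / 2) (by linarith) (by linarith) c c' a b hc hc'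
  rw [show 2 * (r / 2) = r by ring, Subtype.dist_eq, Subtype.dist_eq, hcz, hcx] at key
  have m1 := hc'.2.2 (dist p y / 2) ⟨by linarith, by linarith⟩ (r / 2)
    ⟨by linarith, by linarith⟩
  have m2 := hc'.2.2 r ⟨by linarith, by linarith⟩ (dist p y)
    ⟨by linarith, by linarith⟩
  rw [hcb, Subtype.dist_eq, hcy] at m1
  rw [hcb, Subtype.dist_eq, hcw] at m2
  have ab : |dist p y - r| ≤ dist x y := abs_le.2 ⟨by linarith, by linarith⟩
  rw [← sub_div, abs_div, abs_two] at m1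
  rw [abs_sub_comm] at m2
  have u := dist_triangle x y (c' (r / 2) : X)
  have v := dist_triangle z (c' r : X) w
  have : 0 < ε * r := mul_pos hε hr
  linarith
end

section
/- Let (X j), j ∈ ℕ, be a sequence of nonempty compact metric spaces, each admitting a consistent, reversible, convex geodesic bicombing σⱼ : X j → X j → [0,1] → X j. Let Y be a nonempty compact metric space with GromovHausdorff.ghDist (X j) Y → 0 as j → ∞. Then Y admits a consistent, reversible, convex geodesic bicombing. -/
open Set Metric

/-- A geodesic bicombing: a choice of constant-speed geodesics between all
pairs of points. -/
def IsGeodesicBicombing {X : Type*} [MetricSpace X] (σ : X → X → ℝ → X) : Prop :=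
  ∀ x y : X, σ x y 0 = x ∧ σ x y 1 = y ∧
    ∀ s ∈ Set.Icc (0:ℝ) 1, ∀ t ∈ Set.Icc (0:ℝ) 1,
      dist (σ x y s) (σ x y t) = |s - t| * dist x y

/-- Convexity of a geodesic bicombing. -/
def IsConvexBicombing {X : Type*} [MetricSpace X] (σ : X → X → ℝ → X) : Prop :=
  ∀ x y x' y' : X,
    ConvexOn ℝ (Set.Icc (0:ℝ) 1) (fun t => dist (σ x y t) (σ x' y' t))

/-- Consistency of a geodesic bicombing. -/
def IsConsistentBicombing {X : Type*} [MetricSpace X] (σ : X → X → ℝ → X) : Prop :=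
  ∀ x y : X, ∀ s ∈ Set.Icc (0:ℝ) 1, ∀ t ∈ Set.Icc (0:ℝ) 1, s ≤ t →
    ∀ l ∈ Set.Icc (0:ℝ) 1,
      σ (σ x y s) (σ x y t) l = σ x y ((1 - l) * s + l * t)

/-- Reversibility of a geodesic bicombing. -/
def IsReversibleBicombing {X : Type*} [MetricSpace X] (σ : X → X → ℝ → X) : Prop :=
  ∀ x y : X, ∀ t ∈ Set.Icc (0:ℝ) 1, σ x y t = σ y x (1 - t)

open Filter Topology in
lemma gh_approx_maps {X Y : Type*} [MetricSpace X] [CompactSpace X] [Nonempty X]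
    [MetricSpace Y] [CompactSpace Y] [Nonempty Y] {r : ℝ}
    (hr : GromovHausdorff.ghDist X Y < r) :
    ∃ (f : X → Y) (g : Y → X), (∀ x x', |dist (f x) (f x') - dist x x'| ≤ 2 * r) ∧
      ∀ y, dist (f (g y)) y ≤ 2 * r := by
  obtain ⟨Φ, Ψ, hΦ, hΨ, h⟩ := GromovHausdorff.ghDist_eq_hausdorffDist X Y
  rw [h] at hr
  have fin : Metric.hausdorffEDist (range Φ) (range Ψ) ≠ ⊤ :=
    Metric.hausdorffEDist_ne_top_of_nonempty_of_bounded (range_nonempty _) (range_nonempty _)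
      (isCompact_range hΦ.continuous).isBounded (isCompact_range hΨ.continuous).isBounded
  have h1 : ∀ x, ∃ y, dist (Φ x) (Ψ y) < r := by
    intro x
    obtain ⟨_, ⟨y, rfl⟩, hy⟩ :=
      Metric.exists_dist_lt_of_hausdorffDist_lt (mem_range_self x) hr fin
    exact ⟨y, hy⟩
  have h2 : ∀ y, ∃ x, dist (Φ x) (Ψ y) < r := by
    intro y
    obtain ⟨_, ⟨x, rfl⟩, hy⟩ :=
      Metric.exists_dist_lt_of_hausdorffDist_lt' (mem_range_self y) hr fin
    exact ⟨x, hy⟩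
  choose f hf using h1
  choose g hg using h2
  refine ⟨f, g, fun x x' => ?_, fun y => ?_⟩
  · rw [← hΦ.dist_eq x x', ← hΨ.dist_eq (f x) (f x'), abs_le]
    have a := hf x
    have b := hf x'
    have c := dist_triangle4 (Φ x) (Ψ (f x)) (Ψ (f x')) (Φ x')
    have d := dist_triangle4 (Ψ (f x)) (Φ x) (Φ x') (Ψ (f x'))
    rw [dist_comm (Ψ (f x')) (Φ x')] at c
    rw [dist_comm (Ψ (f x)) (Φ x)] at d
    constructor <;> linarith
  · rw [← hΨ.dist_eq]
    have a := hf (g y)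
    have b := hg y
    have c := dist_triangle_left (Ψ (f (g y))) (Ψ y) (Φ (g y))
    linarith

/-- A Gromov--Hausdorff limit of compact spaces with consistent, reversible,
convex geodesic bicombings admits such a bicombing. -/
theorem bicombing_stable_under_gh_convergence
    (X : ℕ → Type*) [∀ j, MetricSpace (X j)] [∀ j, CompactSpace (X j)]
    [∀ j, Nonempty (X j)]
    (hσ : ∀ j, ∃ σ : X j → X j → ℝ → X j, IsGeodesicBicombing σ ∧
      IsConvexBicombing σ ∧ IsConsistentBicombing σ ∧ IsReversibleBicombing σ)
    (Y : Type*) [MetricSpace Y] [CompactSpace Y] [Nonempty Y]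
    (hGH : Filter.Tendsto (fun j => GromovHausdorff.ghDist (X j) Y)
      Filter.atTop (nhds 0)) :
    ∃ σ : Y → Y → ℝ → Y, IsGeodesicBicombing σ ∧
      IsConvexBicombing σ ∧ IsConsistentBicombing σ ∧ IsReversibleBicombing σ := by
  classical
  let U : Ultrafilter ℕ := Filter.hyperfilter ℕ
  have hU : (U : Filter ℕ) ≤ Filter.atTop := by
    rw [← Nat.cofinite_eq_atTop]; exact Filter.hyperfilter_le_cofinite
  let r : ℕ → ℝ := fun j => GromovHausdorff.ghDist (X j) Y + 1 / ((j : ℝ) + 1)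
  have hr : Filter.Tendsto (fun j => 2 * r j) U (nhds 0) := by
    have := ((hGH.add tendsto_one_div_add_atTop_nhds_zero_nat).const_mul 2).mono_left hU
    simpa [r] using this
  have hlt : ∀ j, GromovHausdorff.ghDist (X j) Y < r j := fun j => by
    have : (0:ℝ) < 1 / ((j : ℝ) + 1) := by positivity
    simp only [r]; linarith
  choose f g hf hg using fun j => gh_approx_maps (hlt j)
  choose S hgeo hconv hcons hrev using hσ
  have hex : ∀ p : (∀ j, X j), ∃ y, Filter.Tendsto (fun j => f j (p j)) U (nhds y) := by
    intro p
    obtain ⟨y, -, hy⟩ := isCompact_univ.ultrafilter_le_nhds (U.map (fun j => f j (p j)))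
      (by simp)
    exact ⟨y, hy⟩
  choose L hL using hex
  have hLd : ∀ p q, Filter.Tendsto (fun j => dist (p j) (q j)) U (nhds (dist (L p) (L q))) := by
    intro p q
    have h1 := (hL p).dist (hL q)
    have h2 : Filter.Tendsto
        (fun j => dist (f j (p j)) (f j (q j)) - dist (p j) (q j)) U (nhds 0) :=
      squeeze_zero_norm (fun j => hf j (p j) (q j)) hr
    simpa using h1.sub h2
  have hLg : ∀ y, L (fun j => g j y) = y := by
    intro y
    have h1 : Filter.Tendsto (fun j => f j (g j y)) U (nhds y) :=
      tendsto_iff_dist_tendsto_zero.2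
        (squeeze_zero (fun _ => dist_nonneg) (fun j => hg j y) hr)
    exact tendsto_nhds_unique (hL _) h1
  have hLeq : ∀ p q, L p = L q → Filter.Tendsto (fun j => dist (p j) (q j)) U (nhds 0) := by
    intro p q h
    have := hLd p q
    rwa [h, dist_self] at this
  have hLeq' : ∀ p q, Filter.Tendsto (fun j => dist (p j) (q j)) U (nhds 0) → L p = L q := by
    intro p q h
    exact dist_eq_zero.1 (tendsto_nhds_unique (hLd p q) h)
  refine ⟨fun x y t => L (fun j => S j (g j x) (g j y) t), ?_, ?_, ?_, ?_⟩
  · intro x y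
    refine ⟨?_, ?_, ?_⟩
    · simp only [(hgeo _ _ _).1, hLg]
    · simp only [(hgeo _ _ _).2.1, hLg]
    · intro s hs t ht
      refine tendsto_nhds_unique (hLd _ _) ?_
      have h1 := (hLd (fun j => g j x) (fun j => g j y)).const_mul |s - t|
      rw [hLg, hLg] at h1
      exact h1.congr fun j => ((hgeo j _ _).2.2 s hs t ht).symm
  · intro x y x' y'
    refine ⟨convex_Icc 0 1, fun s hs t ht a b ha hb hab => ?_⟩
    refine le_of_tendsto_of_tendsto' (hLd _ _)
      (((hLd _ _).const_mul a).add ((hLd _ _).const_mul b)) fun j => ?_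
    exact (hconv j (g j x) (g j y) (g j x') (g j y')).2 hs ht ha hb hab
  · intro x y s hs t ht hst l hl
    refine hLeq' _ _ ?_
    have h1 := hLeq _ _ (hLg (L (fun j => S j (g j x) (g j y) s)))
    have h2 := hLeq _ _ (hLg (L (fun j => S j (g j x) (g j y) t)))
    have h3 := (h1.const_mul (1 - l)).add (h2.const_mul l)
    rw [mul_zero, mul_zero, add_zero] at h3
    refine squeeze_zero (fun _ => dist_nonneg) (fun j => ?_) h3
    rw [← hcons j (g j x) (g j y) s hs t ht hst l hl]
    have h4 := (hconv j (g j (L (fun j => S j (g j x) (g j y) s)))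
      (g j (L (fun j => S j (g j x) (g j y) t)))
      (S j (g j x) (g j y) s) (S j (g j x) (g j y) t)).2
      (left_mem_Icc.2 zero_le_one) (right_mem_Icc.2 zero_le_one)
      (sub_nonneg.2 hl.2) hl.1 (sub_add_cancel 1 l)
    simpa [(hgeo j _ _).1, (hgeo j _ _).2.1] using h4
  · intro x y t ht
    exact congrArg L (funext fun j => hrev j _ _ t ht)
end
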